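/- arXiv:1604.07967 — 4 statements merged into one kernel-verified Lean document; each statement's English description precedes it below -/
import Mathlib

section
/- Let (L,(·,·),Φ) be a p.n. root lattice and let A ⊆ Φ be any set of roots which generates L as a ℤ-module. Then A contains a subset which is a ℤ-basis of L. -/
open Submodule

/-- A (possibly nonreduced) root lattice, modeled inside the ℚ-vector space `V = L ⊗ ℚ`
(the lattice itself is `L = span ℤ Φ`, a free ℤ-module of rank `dim V ≥ 1`). -/
structure IsPNRootLattice {V : Type} [AddCommGroup V] [Module ℚ V]
    (B : V →ₗ[ℚ] V →ₗ[ℚ] ℚ) (Φ : Set V) : Prop where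
  finite : Φ.Finite
  nonempty : Φ.Nonempty
  ne_zero : ∀ α ∈ Φ, α ≠ 0
  symm : ∀ x y : V, B x y = B y x
  posdef : ∀ x : V, x ≠ 0 → 0 < B x x
  pair_int : ∀ α ∈ Φ, ∀ β ∈ Φ, ∃ c : ℤ, 2 * B β α = (c : ℚ) * B α α
  refl_maps : ∀ α ∈ Φ, (fun x => x - (2 * B x α / B α α) • α) '' Φ = Φ
  span_rat : span ℚ Φ = ⊤

lemma aux_denoms (T : Set ℚ) (hT : T.Finite) : ∃ N : ℤ, 0 < N ∧ ∀ q ∈ T, ∃ z : ℤ, (N : ℚ) * q = z := by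
  induction T, hT using Set.Finite.induction_on with
  | empty => exact ⟨1, one_pos, by simp⟩
  | @insert a s _ _ ih =>
    obtain ⟨N, hN, h⟩ := ih
    refine ⟨N * a.den, mul_pos hN (by exact_mod_cast a.den_pos), ?_⟩
    rintro q (rfl | hq)
    · refine ⟨N * q.num, ?_⟩
      push_cast
      rw [mul_assoc, mul_comm (q.den : ℚ), Rat.mul_den_eq_num]
    · obtain ⟨z, hz⟩ := h q hq
      refine ⟨z * a.den, ?_⟩
      push_cast
      rw [← hz]; ring

/-- A point of the coroot lattice closest to `x`. -/
lemma aux_closest {V : Type} [AddCommGroup V] [Module ℚ V]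
    (B : V →ₗ[ℚ] V →ₗ[ℚ] ℚ) (Φ : Set V) (h : IsPNRootLattice B Φ) (x : V) :
    ∃ v : V, (∀ γ ∈ Φ, ∃ z : ℤ, B v γ = z) ∧ ∀ γ ∈ Φ, B x γ - B v γ ≤ 1 := by
  classical
  let C : Set V := (fun γ => (2 / B γ γ) • γ) '' Φ
  have hC : C.Finite := h.finite.image _
  let G : AddSubgroup V := AddSubgroup.closure C
  obtain ⟨N, hN, hNz⟩ := aux_denoms
    (((fun c => B x c) '' C) ∪ ((fun p : V × V => B p.1 p.2) '' (C ×ˢ C)))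
    ((hC.image _).union ((hC.prod hC).image _))
  have hx : ∀ v ∈ G, ∃ z : ℤ, (N : ℚ) * B x v = z := by
    intro v hv
    induction hv using AddSubgroup.closure_induction with
    | mem c hc => exact hNz _ (Or.inl ⟨c, hc, rfl⟩)
    | zero => exact ⟨0, by simp⟩
    | add a b _ _ ha hb =>
      obtain ⟨y, hy⟩ := ha
      obtain ⟨z, hz⟩ := hb
      exact ⟨y + z, by rw [map_add, mul_add, hy, hz]; push_cast; ring⟩
    | neg a _ ha =>
      obtain ⟨y, hy⟩ := ha
      exact ⟨-y, by rw [map_neg, mul_neg, hy]; push_cast; ring⟩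
  have hcc : ∀ c ∈ C, ∀ v ∈ G, ∃ z : ℤ, (N : ℚ) * B c v = z := by
    intro c hc v hv
    induction hv using AddSubgroup.closure_induction with
    | mem c' hc' => exact hNz _ (Or.inr ⟨(c, c'), ⟨hc, hc'⟩, rfl⟩)
    | zero => exact ⟨0, by simp⟩
    | add a b _ _ ha hb =>
      obtain ⟨y, hy⟩ := ha
      obtain ⟨z, hz⟩ := hb
      exact ⟨y + z, by rw [map_add, mul_add, hy, hz]; push_cast; ring⟩
    | neg a _ ha =>
      obtain ⟨y, hy⟩ := ha
      exact ⟨-y, by rw [map_neg, mul_neg, hy]; push_cast; ring⟩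
  have hvv : ∀ w ∈ G, ∀ v ∈ G, ∃ z : ℤ, (N : ℚ) * B w v = z := by
    intro w hw v hv
    induction hw using AddSubgroup.closure_induction with
    | mem c hc => exact hcc c hc v hv
    | zero => exact ⟨0, by simp⟩
    | add a b _ _ ha hb =>
      obtain ⟨y, hy⟩ := ha
      obtain ⟨z, hz⟩ := hb
      exact ⟨y + z, by rw [map_add, LinearMap.add_apply, mul_add, hy, hz]; push_cast; ring⟩
    | neg a _ ha =>
      obtain ⟨y, hy⟩ := ha
      exact ⟨-y, by rw [map_neg, LinearMap.neg_apply, mul_neg, hy]; push_cast; ring⟩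
  have hNq : (0 : ℚ) < N := by exact_mod_cast hN
  have hnn : ∀ y : V, 0 ≤ B y y := by
    intro y
    by_cases hy : y = 0
    · simp [hy]
    · exact (h.posdef y hy).le
  have hmin : ∃ lb : ℤ, (∃ v ∈ G, (N : ℚ) * (B v v - 2 * B x v) = lb) ∧
      ∀ z : ℤ, (∃ v ∈ G, (N : ℚ) * (B v v - 2 * B x v) = z) → lb ≤ z := by
    apply Int.exists_least_of_bdd
    · refine ⟨⌊-((N : ℚ) * B x x)⌋, ?_⟩
      rintro z ⟨v, _, hz⟩
      have h1 := hnn (x - v)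
      simp only [map_sub, LinearMap.sub_apply] at h1
      rw [h.symm v x] at h1
      have : -((N : ℚ) * B x x) ≤ z := by rw [← hz]; nlinarith
      exact_mod_cast (Int.floor_le _).trans this
    · exact ⟨0, 0, G.zero_mem, by simp⟩
  obtain ⟨m, ⟨v, hvG, hvm⟩, hm⟩ := hmin
  refine ⟨v, ?_, ?_⟩
  · intro γ hγ
    have : ∀ w ∈ G, ∃ z : ℤ, B w γ = z := by
      intro w hw
      induction hw using AddSubgroup.closure_induction with
      | mem c hc =>
        obtain ⟨δ, hδ, rfl⟩ := hc
        obtain ⟨z, hz⟩ := h.pair_int δ hδ γ hγ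
        refine ⟨z, ?_⟩
        have := h.posdef δ (h.ne_zero δ hδ)
        simp only [map_smul, LinearMap.smul_apply, smul_eq_mul]
        rw [h.symm δ γ]
        field_simp
        linarith
      | zero => exact ⟨0, by simp⟩
      | add a b _ _ ha hb =>
        obtain ⟨y, hy⟩ := ha
        obtain ⟨z, hz⟩ := hb
        exact ⟨y + z, by rw [map_add, LinearMap.add_apply, hy, hz]; push_cast; ring⟩
      | neg a _ ha =>
        obtain ⟨y, hy⟩ := ha
        exact ⟨-y, by rw [map_neg, LinearMap.neg_apply, hy]; push_cast; ring⟩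
    exact this v hvG
  · intro γ hγ
    have hpos := h.posdef γ (h.ne_zero γ hγ)
    set c : V := (2 / B γ γ) • γ with hc
    have hcG : c ∈ G := AddSubgroup.subset_closure ⟨γ, hγ, rfl⟩
    have hvc : v + c ∈ G := G.add_mem hvG hcG
    obtain ⟨z1, hz1⟩ := hvv _ hvc _ hvc
    obtain ⟨z2, hz2⟩ := hx _ hvc
    have hle := hm (z1 - 2 * z2) ⟨v + c, hvc, by push_cast; rw [← hz1, ← hz2]; ring⟩
    have hle' : (m : ℚ) ≤ z1 - 2 * z2 := by exact_mod_cast hle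
    rw [← hvm, ← hz1, ← hz2] at hle'
    have h3 : B v v - 2 * B x v ≤ B (v + c) (v + c) - 2 * B x (v + c) := by
      by_contra hlt
      push Not at hlt
      have := mul_lt_mul_of_pos_left hlt hNq
      linarith
    simp only [map_add, LinearMap.add_apply] at h3
    rw [h.symm c v] at h3
    have e1 : B v c = 2 / B γ γ * B v γ := by simp [hc]
    have e2 : B x c = 2 / B γ γ * B x γ := by simp [hc]
    have e3 : B c c = 2 / B γ γ * 2 := by
      simp only [hc, map_smul, LinearMap.smul_apply, smul_eq_mul]
      field_simp
    rw [e1, e2, e3] at h3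
    have hp : 0 < 2 / B γ γ := by positivity
    by_contra hlt
    push Not at hlt
    nlinarith [mul_lt_mul_of_pos_left hlt hp]

lemma aux_neg {V : Type} [AddCommGroup V] [Module ℚ V]
    (B : V →ₗ[ℚ] V →ₗ[ℚ] ℚ) (Φ : Set V) (h : IsPNRootLattice B Φ) (γ : V) (hγ : γ ∈ Φ) :
    -γ ∈ Φ := by
  have hpos := h.posdef γ (h.ne_zero γ hγ)
  have h1 : γ - (2 * B γ γ / B γ γ) • γ ∈ Φ := by
    have := h.refl_maps γ hγ
    rw [← this]
    exact ⟨γ, hγ, rfl⟩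
  rw [mul_div_cancel_right₀ _ hpos.ne'] at h1
  convert h1 using 1
  module

lemma aux_int_pos {V : Type} [AddCommGroup V] [Module ℚ V] [FiniteDimensional ℚ V]
    (B : V →ₗ[ℚ] V →ₗ[ℚ] ℚ) (Φ : Set V) (h : IsPNRootLattice B Φ)
    {ι : Type} [Fintype ι] (b : Module.Basis ι ℚ V) (hb : ∀ i, b i ∈ Φ)
    (β : V) (hβ : β ∈ Φ) (c : ι → ℚ) (hc : β = ∑ i, c i • b i)
    (hc1 : ∀ i, c i = 0 ∨ 1 ≤ |c i|) (j : ι) : ∃ z : ℤ, c j = z := by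
  classical
  by_contra hj
  have hj' : ¬ ∃ z : ℤ, |c j| = z := by
    rintro ⟨z, hz⟩
    rcases abs_choice (c j) with h' | h'
    · exact hj ⟨z, by rw [← hz, h']⟩
    · exact hj ⟨-z, by push_cast; rw [← hz, h']; ring⟩
  let s : ι → ℚ := fun i => if 0 ≤ c i then 1 else -1
  have hs : ∀ i, c i * s i = |c i| := by
    intro i
    by_cases hi : 0 ≤ c i
    · simp [s, hi, abs_of_nonneg hi]
    · simp [s, hi, abs_of_neg (not_le.mp hi)]
  have hss : ∀ i, s i * s i = 1 := by
    intro i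
    by_cases hi : 0 ≤ c i <;> simp [s, hi]
  have hsb : ∀ i, s i • b i ∈ Φ := by
    intro i
    by_cases hi : 0 ≤ c i
    · simpa [s, hi] using hb i
    · simpa [s, hi] using aux_neg B Φ h _ (hb i)
  have hinj : Function.Injective B := by
    rw [injective_iff_map_eq_zero]
    intro a ha
    by_contra hne
    have := h.posdef a hne
    rw [ha] at this
    simp at this
  have hsurj : Function.Surjective B :=
    (LinearMap.injective_iff_surjective_of_finrank_eq_finrank
      (Subspace.dual_finrank_eq (K := ℚ) (V := V)).symm).mp hinj
  have hfl : |c j| < ⌊|c j|⌋ + 1 := Int.lt_floor_add_one _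
  have hsum : 0 ≤ ∑ i, |c i| := Finset.sum_nonneg fun i _ => abs_nonneg _
  obtain ⟨t, ht, htlt⟩ : ∃ t : ℚ, 0 < t ∧ t * (∑ i, |c i|) < ⌊|c j|⌋ + 1 - |c j| := by
    refine ⟨(⌊|c j|⌋ + 1 - |c j|) / ((∑ i, |c i|) + 1), by apply div_pos <;> linarith, ?_⟩
    rw [div_mul_eq_mul_div, div_lt_iff₀ (by linarith)]
    nlinarith
  obtain ⟨x, hx⟩ := hsurj (b.constr ℚ fun i => s i * ((if i = j then 1 else 0) + t))
  have hxb : ∀ i, B x (b i) = s i * ((if i = j then 1 else 0) + t) := by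
    intro i
    rw [hx, Module.Basis.constr_basis]
  obtain ⟨v, hvz, hv1⟩ := aux_closest B Φ h x
  -- nonnegativity
  choose n hn using fun i => hvz _ (hsb i)
  have hn0 : ∀ i, (if i = j then 1 else 0 : ℤ) ≤ n i := by
    intro i
    have h1 := hv1 _ (hsb i)
    rw [hn i, map_smul, hxb, smul_eq_mul, ← mul_assoc, hss] at h1
    have h2 : ((if i = j then 1 else 0 : ℤ) : ℚ) - 1 < n i := by
      push_cast
      linarith
    have h3 : (if i = j then 1 else 0 : ℤ) - 1 < n i := by exact_mod_cast h2
    linarith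
  have hvβ : B v β = ∑ i, |c i| * n i := by
    rw [hc, map_sum]
    refine Finset.sum_congr rfl fun i _ => ?_
    rw [← hn, map_smul, map_smul, smul_eq_mul, smul_eq_mul, ← hs]
    linear_combination (-(c i) * B v (b i)) * hss i
  have hxβ : B x β = |c j| + t * ∑ i, |c i| := by
    have : B x β = ∑ i, (|c i| * (if i = j then 1 else 0) + t * |c i|) := by
      rw [hc, map_sum]
      refine Finset.sum_congr rfl fun i _ => ?_
      rw [map_smul, hxb, smul_eq_mul, ← hs]
      ring
    rw [this, Finset.sum_add_distrib, ← Finset.mul_sum]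
    simp
  obtain ⟨z, hz⟩ := hvz β hβ
  have hzle : z ≤ ⌊|c j|⌋ + 1 := by
    have h1 := hv1 _ (aux_neg B Φ h β hβ)
    rw [map_neg, map_neg, hxβ, hz] at h1
    have h2 : (z : ℚ) < ⌊|c j|⌋ + 1 + 1 := by linarith
    have h3 : z < ⌊|c j|⌋ + 1 + 1 := by exact_mod_cast h2
    omega
  let k : ι → ℤ := fun i => n i - if i = j then 1 else 0
  have hk0 : ∀ i, 0 ≤ k i := fun i => sub_nonneg.mpr (hn0 i)
  have hzk : (z : ℚ) = |c j| + ∑ i, |c i| * k i := by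
    rw [← hz, hvβ]
    have : ∀ i, |c i| * (n i : ℚ) = |c i| * (if i = j then 1 else 0) + |c i| * k i := by
      intro i
      simp only [k]
      push_cast
      ring
    rw [Finset.sum_congr rfl fun i _ => this i, Finset.sum_add_distrib]
    simp
  have hflt : (⌊|c j|⌋ : ℚ) < |c j| :=
    lt_of_le_of_ne (Int.floor_le _) fun he => hj' ⟨_, he.symm⟩
  have hzle' : (z : ℚ) ≤ ⌊|c j|⌋ + 1 := by exact_mod_cast hzle
  have hlt1 : ∑ i, |c i| * (k i : ℚ) < 1 := by linarith
  have hterm : ∀ i, |c i| * (k i : ℚ) = 0 := by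
    intro i
    by_contra hne
    have hci : c i ≠ 0 := fun h0 => hne (by simp [h0])
    have hki : k i ≠ 0 := fun h0 => hne (by simp [h0])
    have h1 : 1 ≤ |c i| := (hc1 i).resolve_left hci
    have h2 : (1 : ℚ) ≤ k i := by
      have := hk0 i
      exact_mod_cast (by omega : 1 ≤ k i)
    have h3 : |c i| * (k i : ℚ) ≤ ∑ i, |c i| * (k i : ℚ) :=
      Finset.single_le_sum (f := fun i => |c i| * (k i : ℚ))
        (fun i _ => mul_nonneg (abs_nonneg _) (by exact_mod_cast hk0 i)) (Finset.mem_univ i)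
    nlinarith
  rw [Finset.sum_eq_zero fun i _ => hterm i, add_zero] at hzk
  exact hj' ⟨z, hzk.symm⟩

/-- Any set of roots generating the lattice `L = span ℤ Φ` as a ℤ-module contains a
ℤ-basis of `L` (a ℤ-linearly independent subset which still generates `L`). -/
theorem stmt0 {V : Type} [AddCommGroup V] [Module ℚ V] [FiniteDimensional ℚ V] [Nontrivial V]
    (B : V →ₗ[ℚ] V →ₗ[ℚ] ℚ) (Φ : Set V) (h : IsPNRootLattice B Φ)
    (A : Set V) (hA : A ⊆ Φ) (hgen : span ℤ A = span ℤ Φ) :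
    ∃ A' ⊆ A, LinearIndependent ℤ (fun a : A' => (a : V)) ∧ span ℤ A' = span ℤ Φ := by
  classical
  have hspanA : span ℚ A = ⊤ := by
    rw [eq_top_iff, ← h.span_rat, span_le]
    intro γ hγ
    have h1 : γ ∈ span ℤ A := hgen ▸ subset_span hγ
    exact Submodule.span_le_restrictScalars ℤ ℚ A h1
  obtain ⟨S, hSA, hSspan, hSli⟩ := exists_linearIndependent ℚ A
  have hSfin : S.Finite := (h.finite.subset hA).subset hSA
  haveI : Fintype S := hSfin.fintype
  let e : Module.Basis S ℚ V := Module.Basis.mk hSli (by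
    rw [Subtype.range_coe, hSspan, hspanA])
  have he : ∀ i, e i = (i : V) := fun i => by simp [e]
  let F : Set (S → V) := {a | (∀ i, a i ∈ A) ∧ e.det a ≠ 0}
  have hF : F.Finite := by
    refine (Set.Finite.pi' (t := fun _ : S => A) fun _ => h.finite.subset hA).subset ?_
    rintro a ⟨ha, _⟩
    exact ha
  have hFne : F.Nonempty := ⟨e, fun i => by rw [he]; exact hSA i.2, by simp [e.det_self]⟩
  obtain ⟨a, ⟨haA, hadet⟩, hmin⟩ := Set.exists_min_image F (fun a => |e.det a|) hF hFne
  obtain ⟨hli, hsp⟩ := (e.is_basis_iff_det).mpr (isUnit_iff_ne_zero.mpr hadet)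
  let b : Module.Basis S ℚ V := Module.Basis.mk hli hsp.ge
  have hb : ∀ i, b i = a i := fun i => by simp [b]
  refine ⟨Set.range a, by rintro _ ⟨i, rfl⟩; exact haA i, ?_, ?_⟩
  · exact (hli.restrict_scalars (by
      intro x y hxy
      simpa using hxy)).linearIndepOn_id
  · rw [← hgen]
    apply le_antisymm
    · apply span_mono
      rintro _ ⟨i, rfl⟩
      exact haA i
    · rw [span_le]
      intro β hβ
      have hrep := b.sum_repr β
      have hco : ∀ i, e.det (Function.update a i β) = e.det a * b.repr β i := by
        intro i
        have := e.det_smul_mk_coord_eq_det_update hli hsp.ge i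
        have := congrArg (fun f => f β) this
        simpa [b] using this.symm
      have hc1 : ∀ i, b.repr β i = 0 ∨ 1 ≤ |b.repr β i| := by
        intro i
        by_cases h0 : b.repr β i = 0
        · exact Or.inl h0
        · right
          have := hmin (Function.update a i β) ⟨?_, ?_⟩
          · simp only [hco, abs_mul] at this
            have hp : 0 < |e.det a| := abs_pos.mpr hadet
            by_contra hlt
            push Not at hlt
            nlinarith
          · intro k
            by_cases hk : k = i
            · subst hk; simpa using hβ
            · simpa [hk] using haA k
          · rw [hco]; exact mul_ne_zero hadet h0
      have hint := aux_int_pos B Φ h b (fun i => by rw [hb]; exact hA (haA i)) β (hA hβ)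
        (fun i => b.repr β i) hrep.symm hc1
      rw [← hrep]
      refine Submodule.sum_mem _ fun i _ => ?_
      obtain ⟨z, hz⟩ := hint i
      rw [hz, hb, Int.cast_smul_eq_zsmul]
      exact Submodule.smul_mem _ _ (subset_span ⟨i, rfl⟩)
end

section
/- Let (L,(·,·),Φ) be a p.n. root lattice with Weyl group W and let (α_1,…,α_k) be a presentation of an element w ∈ W. Then the presentation is reduced (i.e. k = l(w)) if and only if α_1,…,α_k are linearly independent in L ⊗ ℚ. -/
open Submodule

/-- The reflection `s_α : x ↦ x - (2 (x,α) / (α,α)) • α`, as a ℚ-linear endomorphism. -/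
noncomputable def reflV {V : Type} [AddCommGroup V] [Module ℚ V]
    (B : V →ₗ[ℚ] V →ₗ[ℚ] ℚ) (α : V) : Module.End ℚ V :=
  LinearMap.id - ((2 / B α α) • (B.flip α)).smulRight α

/-- `(α_1, …, α_k)` is a presentation of `w`: all `α_i` are roots and
`w = s_{α_1} ∘ ⋯ ∘ s_{α_k}`. -/
def IsPres {V : Type} [AddCommGroup V] [Module ℚ V]
    (B : V →ₗ[ℚ] V →ₗ[ℚ] ℚ) (Φ : Set V) (w : Module.End ℚ V) (l : List V) : Prop :=
  (∀ α ∈ l, α ∈ Φ) ∧ (l.map (reflV B)).prod = w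

/-- The length `l(w)`: the minimal length of a presentation of `w`. -/
noncomputable def len {V : Type} [AddCommGroup V] [Module ℚ V]
    (B : V →ₗ[ℚ] V →ₗ[ℚ] ℚ) (Φ : Set V) (w : Module.End ℚ V) : ℕ :=
  sInf {k | ∃ l : List V, IsPres B Φ w l ∧ l.length = k}

section helpers

variable {V : Type} [AddCommGroup V] [Module ℚ V]
  {B : V →ₗ[ℚ] V →ₗ[ℚ] ℚ} {Φ : Set V}

theorem reflV_app (α x : V) : reflV B α x = x - (2 * B x α / B α α) • α := by
  simp only [reflV, LinearMap.sub_apply, LinearMap.id_apply, LinearMap.smulRight_apply,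
    LinearMap.smul_apply, LinearMap.flip_apply, smul_eq_mul]
  congr 2
  ring

theorem reflV_self (h : IsPNRootLattice B Φ) {α : V} (hα : α ∈ Φ) : reflV B α α = -α := by
  have h1 := (h.posdef α (h.ne_zero α hα)).ne'
  rw [reflV_app, mul_div_assoc, div_self h1]
  module

theorem reflV_isom (h : IsPNRootLattice B Φ) {α : V} (hα : α ∈ Φ) (x y : V) :
    B (reflV B α x) (reflV B α y) = B x y := by
  have h1 := (h.posdef α (h.ne_zero α hα)).ne'
  simp only [reflV_app, map_sub, map_smul, LinearMap.sub_apply, LinearMap.smul_apply, smul_eq_mul]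
  rw [h.symm α y]
  field_simp
  ring

theorem reflV_invol (h : IsPNRootLattice B Φ) {α : V} (hα : α ∈ Φ) :
    reflV B α * reflV B α = 1 := by
  ext x
  have h1 := (h.posdef α (h.ne_zero α hα)).ne'
  simp only [Module.End.mul_apply, Module.End.one_apply]
  rw [reflV_app α x, map_sub, map_smul, reflV_self h hα, reflV_app]
  module

theorem reflV_mem (h : IsPNRootLattice B Φ) {α β : V} (hα : α ∈ Φ) (hβ : β ∈ Φ) :
    reflV B α β ∈ Φ := by
  rw [reflV_app, ← h.refl_maps α hα]
  exact ⟨β, hβ, rfl⟩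

theorem rl_neg_mem (h : IsPNRootLattice B Φ) {α : V} (hα : α ∈ Φ) : -α ∈ Φ := by
  rw [← reflV_self h hα]; exact reflV_mem h hα hα

theorem reflV_smul (t : ℚ) (ht : t ≠ 0) (α : V) : reflV B (t • α) = reflV B α := by
  ext x
  simp only [reflV_app, map_smul, LinearMap.smul_apply, smul_eq_mul, smul_smul]
  congr 2
  by_cases h1 : B α α = 0
  · simp [h1]
  · field_simp

theorem reflV_conj (g : Module.End ℚ V) (hg : ∀ x y, B (g x) (g y) = B x y) (α : V) :
    g * reflV B α = reflV B (g α) * g := by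
  ext x
  simp only [Module.End.mul_apply, reflV_app, map_sub, map_smul, hg]

theorem prod_isom (h : IsPNRootLattice B Φ) (l : List V) (hl : ∀ α ∈ l, α ∈ Φ) (x y : V) :
    B ((l.map (reflV B)).prod x) ((l.map (reflV B)).prod y) = B x y := by
  induction l with
  | nil => simp
  | cons a l ih =>
    simp only [List.map_cons, List.prod_cons, Module.End.mul_apply]
    rw [reflV_isom h (hl a (by simp)), ih (fun α hα => hl α (by simp [hα]))]

theorem rl_prod_mem (h : IsPNRootLattice B Φ) (l : List V) (hl : ∀ α ∈ l, α ∈ Φ) {x : V}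
    (hx : x ∈ Φ) : (l.map (reflV B)).prod x ∈ Φ := by
  induction l with
  | nil => simpa
  | cons a l ih =>
    simp only [List.map_cons, List.prod_cons, Module.End.mul_apply]
    exact reflV_mem h (hl a (by simp)) (ih (fun α hα => hl α (by simp [hα])))

/-- A simple system attached to a regular vector `v`. -/
structure Simp (B : V →ₗ[ℚ] V →ₗ[ℚ] ℚ) (Φ : Set V) (v : V) (S : Set V) : Prop where
  sub : ∀ α ∈ S, α ∈ Φ
  pos : ∀ α ∈ S, 0 < B v α
  gen : ∀ β ∈ Φ, 0 < B v β → β ∈ PointedCone.hull ℚ S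
  min : ∀ α ∈ S, α ∉ PointedCone.hull ℚ (S \ {α})

theorem exists_simp (h : IsPNRootLattice B Φ) (v : V) : ∃ S, Simp B Φ v S := by
  classical
  have hf : (Φ ∩ {β | 0 < B v β}).Finite := h.finite.subset Set.inter_subset_left
  obtain ⟨S, hS⟩ := exists_minimal_of_wellFoundedLT
    (fun S : Finset V => (∀ α ∈ S, α ∈ Φ ∧ 0 < B v α) ∧
      ∀ β ∈ Φ, 0 < B v β → β ∈ PointedCone.hull ℚ (S : Set V))
    ⟨hf.toFinset, by
      refine ⟨fun α hα => by simpa using hα, fun β hβ hb => ?_⟩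
      apply Submodule.subset_span
      simpa using ⟨hβ, hb⟩⟩
  refine ⟨S, fun α hα => (hS.prop.1 α hα).1, fun α hα => (hS.prop.1 α hα).2, hS.prop.2, ?_⟩
  intro α hα hmem
  have hle : PointedCone.hull ℚ (S : Set V) ≤ PointedCone.hull ℚ ((S : Set V) \ {α}) := by
    apply Submodule.span_le.2
    intro γ hγ
    by_cases hg : γ = α
    · rw [hg]; exact hmem
    · exact Submodule.subset_span ⟨hγ, hg⟩
  have := hS.le_of_le (y := S.erase α) ⟨fun γ hγ => hS.prop.1 γ (Finset.mem_of_mem_erase hγ),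
    fun β hβ hb => by
      have := hle (hS.prop.2 β hβ hb)
      simpa using this⟩ (Finset.erase_subset _ _)
  exact Finset.notMem_erase α S (this hα)

theorem hull_pos {v : V} {S : Set V} (hS : ∀ α ∈ S, 0 < B v α) {z : V}
    (hz : z ∈ PointedCone.hull ℚ S) : z = 0 ∨ 0 < B v z := by
  induction hz using Submodule.span_induction with
  | mem x hx => exact Or.inr (hS x hx)
  | zero => exact Or.inl rfl
  | add x y _ _ hx hy =>
    rcases hx with rfl | hx
    · simpa using hy
    · rcases hy with rfl | hy
      · right; simpa using hx
      · right; rw [map_add]; positivity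
  | smul a x _ hx =>
    rcases hx with rfl | hx
    · left; simp
    · rcases eq_or_lt_of_le a.2 with ha | ha
      · left
        have : a = 0 := Subtype.ext ha.symm
        simp [this]
      · right
        have : a • x = (a : ℚ) • x := rfl
        rw [this, map_smul, smul_eq_mul]
        positivity

theorem hull_decomp {S : Set V} {α : V} (hα : α ∈ S) {x : V} (hx : x ∈ PointedCone.hull ℚ S) :
    ∃ a : ℚ, 0 ≤ a ∧ ∃ z ∈ PointedCone.hull ℚ (S \ {α}), x = a • α + z := by
  have h1 : S = insert α (S \ {α}) := by simp [Set.insert_eq_of_mem hα]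
  rw [h1] at hx
  obtain ⟨a, z, hz, rfl⟩ := Submodule.mem_span_insert.1 hx
  exact ⟨a, a.2, z, hz, rfl⟩

theorem simp_neg (h : IsPNRootLattice B Φ) {v : V} {S : Set V} (hS : Simp B Φ v S) {α β : V}
    (hα : α ∈ S) (hβ : β ∈ Φ) (hb : 0 < B v β) (hn : B v (reflV B α β) < 0) :
    ∃ t : ℚ, t ≠ 0 ∧ β = t • α := by
  have hαΦ := hS.sub α hα
  have h1 := rl_neg_mem h (reflV_mem h hαΦ hβ)
  obtain ⟨a, ha, z, hz, hza⟩ := hull_decomp hα (hS.gen β hβ hb)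
  obtain ⟨b, hb0, z', hz', hzb⟩ := hull_decomp hα (hS.gen _ h1 (by rw [map_neg]; linarith))
  have hpos : ∀ γ ∈ S \ {α}, 0 < B v γ := fun γ hγ => hS.pos γ hγ.1
  rw [reflV_app] at hzb
  set n := 2 * B β α / B α α with hn'
  have hsum : z + z' = (n - a - b) • α := by
    have e1 : z = β - a • α := by rw [hza]; module
    have e2 : z' = -(β - n • α) - b • α := by rw [hzb]; module
    rw [e1, e2]; module
  have hzz := add_mem hz hz'
  by_cases hc : 0 < n - a - b
  · exfalso
    apply hS.min α hα
    have : α = (⟨(n - a - b)⁻¹, by positivity⟩ : {c : ℚ // 0 ≤ c}) • (z + z') := by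
      rw [hsum]
      change α = (n - a - b)⁻¹ • (n - a - b) • α
      rw [smul_smul, inv_mul_cancel₀ hc.ne', one_smul]
    have hsm := Submodule.smul_mem _
      (⟨(n - a - b)⁻¹, by positivity⟩ : {c : ℚ // 0 ≤ c}) hzz
    rwa [← this] at hsm
  · have h2 : B v (z + z') ≤ 0 := by
      rw [hsum, map_smul, smul_eq_mul]
      have := hS.pos α hα
      nlinarith
    have hz0 : z = 0 := by
      rcases hull_pos hpos hz with h3 | h3
      · exact h3
      · rcases hull_pos hpos hz' with h4 | h4
        · rw [h4, add_zero] at h2; linarith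
        · rw [map_add] at h2; linarith
    rw [hz0, add_zero] at hza
    refine ⟨a, ?_, hza⟩
    rintro rfl
    rw [zero_smul] at hza
    exact h.ne_zero β hβ hza

theorem simp_exists (h : IsPNRootLattice B Φ) {v : V} {S : Set V} (hS : Simp B Φ v S) {β : V}
    (hβ : β ∈ Φ) (hb : 0 < B v β) : ∃ α ∈ S, 0 < B β α := by
  by_contra! hc
  have : ∀ z ∈ PointedCone.hull ℚ S, B β z ≤ 0 := by
    intro z hz
    induction hz using Submodule.span_induction with
    | mem x hx => exact hc x hx
    | zero => simp
    | add x y _ _ hx hy => rw [map_add]; linarith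
    | smul a x _ hx =>
      have : a • x = (a : ℚ) • x := rfl
      rw [this, map_smul, smul_eq_mul]
      exact mul_nonpos_of_nonneg_of_nonpos a.2 hx
  have h1 := this β (hS.gen β hβ hb)
  have h2 := h.posdef β (h.ne_zero β hβ)
  linarith

theorem gen_simp (h : IsPNRootLattice B Φ) {v : V} (hv : ∀ α ∈ Φ, B v α ≠ 0) {S : Set V}
    (hS : Simp B Φ v S) {β : V} (hβ : β ∈ Φ) :
    reflV B β ∈ Submonoid.closure (reflV B '' S) := by
  have key : ∀ β ∈ Φ, 0 < B v β → reflV B β ∈ Submonoid.closure (reflV B '' S) := by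
    intro β hβ
    refine Set.WellFoundedOn.induction (r := fun x y => B v x < B v y)
      (P := fun β => 0 < B v β → reflV B β ∈ Submonoid.closure (reflV B '' S))
      (s := Φ) ?_ hβ ?_
    · haveI : IsStrictOrder V (fun x y => B v x < B v y) :=
        { irrefl := fun x => lt_irrefl _
          trans := fun x y z => lt_trans }
      exact h.finite.wellFoundedOn
    · intro β hβ ih hb
      obtain ⟨α, hα, hab⟩ := simp_exists h hS hβ hb
      have hαΦ := hS.sub α hα
      have hm := reflV_mem h hαΦ hβ
      have hs : reflV B α ∈ Submonoid.closure (reflV B '' S) :=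
        Submonoid.subset_closure ⟨α, hα, rfl⟩
      rcases lt_or_gt_of_ne (hv _ hm) with h1 | h1
      · obtain ⟨t, ht, rfl⟩ := simp_neg h hS hα hβ hb h1
        rw [reflV_smul t ht]
        exact hs
      · have hlt : B v (reflV B α β) < B v β := by
          rw [reflV_app, map_sub, map_smul, smul_eq_mul]
          have h2 := h.posdef α (h.ne_zero α hαΦ)
          have h3 := hS.pos α hα
          have : 0 < 2 * B β α / B α α * B v α := by positivity
          linarith
        have h4 := ih _ hm hlt h1
        have h5 : reflV B β = reflV B α * reflV B (reflV B α β) * reflV B α := by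
          rw [mul_assoc, ← reflV_conj _ (reflV_isom h hαΦ), ← mul_assoc, reflV_invol h hαΦ, one_mul]
        rw [h5]
        exact mul_mem (mul_mem hs h4) hs
  rcases lt_or_gt_of_ne (hv β hβ) with h1 | h1
  · have := key (-β) (rl_neg_mem h hβ) (by rw [map_neg]; linarith)
    have h2 := reflV_smul (B := B) (-1) (by norm_num) β
    rw [neg_one_smul] at h2
    rwa [h2] at this
  · exact key β hβ h1

theorem exchange (h : IsPNRootLattice B Φ) {v : V} (hv : ∀ α ∈ Φ, B v α ≠ 0) {S : Set V}
    (hS : Simp B Φ v S) {α : V} (hα : α ∈ S) (l : List V) (hl : ∀ β ∈ l, β ∈ S)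
    (hn : B v ((l.map (reflV B)).prod α) < 0) :
    ∃ l' : List V, (∀ β ∈ l', β ∈ S) ∧ l'.length + 1 = l.length ∧
      (l'.map (reflV B)).prod = (l.map (reflV B)).prod * reflV B α := by
  induction l with
  | nil =>
    have := hS.pos α hα
    simp at hn
    linarith
  | cons b l ih =>
    have hl' : ∀ β ∈ l, β ∈ S := fun β hβ => hl β (by simp [hβ])
    have hb : b ∈ S := hl b (by simp)
    have hlΦ : ∀ β ∈ l, β ∈ Φ := fun β hβ => hS.sub β (hl' β hβ)
    have hm := rl_prod_mem h l hlΦ (hS.sub α hα)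
    simp only [List.map_cons, List.prod_cons, Module.End.mul_apply] at hn ⊢
    rcases lt_or_gt_of_ne (hv _ hm) with h1 | h1
    · obtain ⟨l', h2, h3, h4⟩ := ih hl' h1
      refine ⟨b :: l', ?_, by simp [h3], ?_⟩
      · intro β hβ
        rcases List.mem_cons.1 hβ with rfl | hβ
        · exact hb
        · exact h2 β hβ
      · rw [List.map_cons, List.prod_cons, h4, mul_assoc]
    · obtain ⟨t, ht, h2⟩ := simp_neg h hS hb hm h1 hn
      refine ⟨l, hl', by simp, ?_⟩
      rw [mul_assoc, reflV_conj _ (prod_isom h l hlΦ), h2, reflV_smul t ht, ← mul_assoc,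
        reflV_invol h (hS.sub b hb), one_mul]

theorem free_simp (h : IsPNRootLattice B Φ) {v : V} (hv : ∀ α ∈ Φ, B v α ≠ 0) {S : Set V}
    (hS : Simp B Φ v S) (n : ℕ) : ∀ (l : List V), l.length = n → (∀ β ∈ l, β ∈ S) →
    (l.map (reflV B)).prod v = v → (l.map (reflV B)).prod = 1 := by
  induction n using Nat.strong_induction_on with
  | _ n ih =>
    intro l hn hl hfix
    rcases List.eq_nil_or_concat l with rfl | ⟨l₁, α, rfl⟩
    · simp
    · rw [List.concat_eq_append] at *
      have hα : α ∈ S := hl α (by simp)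
      have hl1 : ∀ β ∈ l₁, β ∈ S := fun β hβ => hl β (by simp [hβ])
      have h1 := prod_isom h (l₁ ++ [α]) (fun β hβ => hS.sub β (hl β hβ)) v α
      rw [hfix] at h1
      have h2 : ((l₁ ++ [α]).map (reflV B)).prod = (l₁.map (reflV B)).prod * reflV B α := by simp
      rw [h2, Module.End.mul_apply, reflV_self h (hS.sub α hα), map_neg, map_neg] at h1
      have h3 := hS.pos α hα
      obtain ⟨l', h4, h5, h6⟩ := exchange h hv hS hα l₁ hl1 (by linarith)
      rw [h2, ← h6] at hfix ⊢
      refine ih l'.length ?_ l' rfl h4 hfix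
      simp at hn
      omega

theorem free_reg (h : IsPNRootLattice B Φ) {v : V} (hv : ∀ α ∈ Φ, B v α ≠ 0)
    (l : List V) (hl : ∀ β ∈ l, β ∈ Φ) (hfix : (l.map (reflV B)).prod v = v) :
    (l.map (reflV B)).prod = 1 := by
  obtain ⟨S, hS⟩ := exists_simp h v
  have h1 : (l.map (reflV B)).prod ∈ Submonoid.closure (reflV B '' S) := by
    apply Submonoid.list_prod_mem
    intro x hx
    obtain ⟨β, hβ, rfl⟩ := List.mem_map.1 hx
    exact gen_simp h hv hS (hl β hβ)
  have h2 : ∃ l' : List V, (∀ β ∈ l', β ∈ S) ∧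
      (l'.map (reflV B)).prod = (l.map (reflV B)).prod := by
    generalize (l.map (reflV B)).prod = w at h1
    clear hfix
    induction h1 using Submonoid.closure_induction with
    | mem x hx =>
      obtain ⟨β, hβ, rfl⟩ := hx
      exact ⟨[β], by simpa using hβ, by simp⟩
    | one => exact ⟨[], by simp, by simp⟩
    | mul x y _ _ hx hy =>
      obtain ⟨a, ha, rfl⟩ := hx
      obtain ⟨b, hb, rfl⟩ := hy
      refine ⟨a ++ b, ?_, by simp⟩
      intro β hβ
      rcases List.mem_append.1 hβ with hβ | hβ
      · exact ha β hβ
      · exact hb β hβ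
  obtain ⟨l', h3, h4⟩ := h2
  rw [← h4] at hfix ⊢
  exact free_simp h hv hS _ l' rfl h3 hfix

theorem exists_root (h : IsPNRootLattice B Φ) (l : List V) (hl : ∀ β ∈ l, β ∈ Φ)
    (hne : (l.map (reflV B)).prod ≠ 1) :
    ∃ α ∈ Φ, ∀ x, (l.map (reflV B)).prod x = x → B x α = 0 := by
  by_contra! hc
  have := h.finite.to_subtype
  obtain ⟨v, hv, hv'⟩ := Module.Dual.exists_forall_mem_ne_zero_of_forall_exists
    (LinearMap.ker ((l.map (reflV B)).prod - 1)) (fun α : Φ => B.flip α.1)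
    (fun α => by
      obtain ⟨x, hx, hx'⟩ := hc α.1 α.2
      exact ⟨x, by simp [LinearMap.mem_ker, hx], by simpa using hx'⟩)
  apply hne
  refine free_reg h (v := v) (fun α hα => hv' ⟨α, hα⟩) l hl ?_
  simpa [LinearMap.mem_ker, sub_eq_zero] using hv

theorem mem_range_of_orth [FiniteDimensional ℚ V] (h : IsPNRootLattice B Φ)
    (g : Module.End ℚ V) (hg : ∀ x y, B (g x) (g y) = B x y) {α : V}
    (hα : ∀ x, g x = x → B x α = 0) : α ∈ LinearMap.range (g - 1) := by
  have hrefl : LinearMap.BilinForm.IsRefl B := fun x y hxy => by rw [h.symm]; exact hxy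
  have hnd : LinearMap.BilinForm.Nondegenerate B := by
    constructor
    · intro x hx
      by_contra hne
      exact (h.posdef x hne).ne' (hx x)
    · intro x hx
      by_contra hne
      exact (h.posdef x hne).ne' (hx x)
  rw [← LinearMap.BilinForm.orthogonal_orthogonal hnd hrefl (LinearMap.range (g - 1))]
  rw [LinearMap.BilinForm.mem_orthogonal_iff]
  intro y hy
  rw [LinearMap.BilinForm.mem_orthogonal_iff] at hy
  apply hα
  have h1 : ∀ x, B (g x) y = B x y := by
    intro x
    have := hy ((g - 1) x) ⟨x, rfl⟩
    simpa [sub_eq_zero] using this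
  by_contra hne
  have h2 := h.posdef (g y - y) (sub_ne_zero.2 hne)
  have h3 := h1 y
  have h4 := hg y y
  have h5 := h.symm y (g y)
  simp only [map_sub, LinearMap.sub_apply] at h2
  linarith

theorem carter [FiniteDimensional ℚ V] (h : IsPNRootLattice B Φ) (n : ℕ) :
    ∀ (l : List V), (∀ β ∈ l, β ∈ Φ) →
    Module.finrank ℚ (LinearMap.range ((l.map (reflV B)).prod - 1)) = n →
    ∃ l' : List V, (∀ β ∈ l', β ∈ Φ) ∧ (l'.map (reflV B)).prod = (l.map (reflV B)).prod ∧
      l'.length ≤ n := by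
  induction n using Nat.strong_induction_on with
  | _ n ih =>
    intro l hl hn
    by_cases h1 : (l.map (reflV B)).prod = 1
    · exact ⟨[], by simp, by simp [h1], by simp⟩
    obtain ⟨α, hα, hort⟩ := exists_root h l hl h1
    have hiso := prod_isom h l hl
    obtain ⟨x, hx⟩ := mem_range_of_orth h _ hiso hort
    set w := (l.map (reflV B)).prod with hw
    have hwx : w x = x + α := by
      rw [← hx]; simp
    have hl2 : ∀ β ∈ α :: l, β ∈ Φ := by
      intro β hβ
      rcases List.mem_cons.1 hβ with rfl | hβ
      · exact hα
      · exact hl β hβ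
    have hp : ((α :: l).map (reflV B)).prod = reflV B α * w := by simp [hw]
    have hB := h.posdef α (h.ne_zero α hα)
    have hxfix : reflV B α (w x) = x := by
      have h2 := hiso x x
      rw [hwx] at h2 ⊢
      simp only [map_add, LinearMap.add_apply] at h2
      rw [h.symm α x] at h2
      rw [reflV_app]
      have : 2 * B (x + α) α / B α α = 1 := by
        rw [div_eq_one_iff_eq hB.ne', map_add, LinearMap.add_apply]
        linarith
      rw [this]; module
    have hlt : LinearMap.ker (w - 1) < LinearMap.ker (reflV B α * w - 1) := by
      refine lt_of_le_of_ne ?_ ?_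
      · intro y hy
        have hy' : w y = y := by simpa [LinearMap.mem_ker, sub_eq_zero] using hy
        rw [LinearMap.mem_ker, LinearMap.sub_apply, Module.End.mul_apply, hy', reflV_app,
          hort y hy']
        simp
      · intro he
        have : x ∈ LinearMap.ker (w - 1) := by
          rw [he, LinearMap.mem_ker, LinearMap.sub_apply, Module.End.mul_apply, hxfix]
          simp
        rw [LinearMap.mem_ker, hx] at this
        exact h.ne_zero α hα this
    have hf := Submodule.finrank_lt_finrank_of_lt hlt
    have e1 := LinearMap.finrank_range_add_finrank_ker (w - 1)
    have e2 := LinearMap.finrank_range_add_finrank_ker (reflV B α * w - 1)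
    obtain ⟨l', h3, h4, h5⟩ := ih (Module.finrank ℚ (LinearMap.range (reflV B α * w - 1)))
      (by omega) (α :: l) hl2 (by rw [hp])
    refine ⟨α :: l', ?_, ?_, ?_⟩
    · intro β hβ
      rcases List.mem_cons.1 hβ with rfl | hβ
      · exact hα
      · exact h3 β hβ
    · rw [List.map_cons, List.prod_cons, h4, hp, ← mul_assoc, reflV_invol h hα, one_mul]
    · rw [List.length_cons]; omega

theorem prod_sub_mem (l : List V) (x : V) :
    (l.map (reflV B)).prod x - x ∈ span ℚ (Set.range l.get) := by
  rw [Set.range_list_get]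
  induction l with
  | nil => simp
  | cons a l ih =>
    have hle : span ℚ {x | x ∈ l} ≤ span ℚ {x | x ∈ a :: l} :=
      span_mono fun y hy => by simp_all
    have ha : a ∈ span ℚ {x | x ∈ a :: l} := subset_span (by simp)
    simp only [List.map_cons, List.prod_cons, Module.End.mul_apply]
    rw [reflV_app, sub_right_comm]
    exact sub_mem (hle ih) (smul_mem _ _ ha)

theorem range_le (l : List V) :
    LinearMap.range ((l.map (reflV B)).prod - 1) ≤ span ℚ (Set.range l.get) := by
  rintro _ ⟨x, rfl⟩
  simpa using prod_sub_mem l x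

theorem finrank_range_le (l : List V) :
    Module.finrank ℚ (span ℚ (Set.range l.get)) ≤ l.length := by
  have := finrank_range_le_card (R := ℚ) l.get
  rw [Fintype.card_fin] at this
  exact this

theorem fix_orth (h : IsPNRootLattice B Φ) (l : List V) (hl : ∀ β ∈ l, β ∈ Φ)
    (hli : LinearIndependent ℚ l.get) (x : V) (hx : (l.map (reflV B)).prod x = x) :
    ∀ α ∈ l, B x α = 0 := by
  induction l with
  | nil => simp
  | cons a l ih =>
    have hg : (a :: l).get = Fin.cons a l.get := by
      funext i
      refine Fin.cases ?_ (fun j => ?_) i <;> rfl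
    rw [hg] at hli
    obtain ⟨h1, h2⟩ := linearIndependent_finCons.1 hli
    simp only [List.map_cons, List.prod_cons, Module.End.mul_apply] at hx
    have ha : a ∈ Φ := hl a (by simp)
    have hB := (h.posdef a (h.ne_zero a ha)).ne'
    set g := (l.map (reflV B)).prod with hgd
    have h3 := prod_sub_mem (B := B) l x
    rw [← hgd] at h3
    rw [reflV_app] at hx
    set c := 2 * B (g x) a / B a a with hc
    have h4 : g x - x = c • a := by
      nth_rewrite 2 [← hx]; module
    have hc0 : c = 0 := by
      by_contra hne
      apply h2
      rw [h4] at h3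
      exact (Submodule.smul_mem_iff _ hne).1 h3
    have hgx : g x = x := by
      rw [hc0, zero_smul] at h4; exact sub_eq_zero.1 h4
    intro α hα
    rcases List.mem_cons.1 hα with rfl | hα
    · rw [hgx] at hc
      rw [hc0] at hc
      rcases div_eq_zero_iff.1 hc.symm with h5 | h5
      · linarith
      · exact absurd h5 hB
    · exact ih (fun β hβ => hl β (by simp [hβ])) h1 hgx α hα

end helpers

/-- A presentation of a Weyl group element `w` is reduced (has minimal length) iff the
roots occurring in it are linearly independent over ℚ. -/
theorem stmt1 {V : Type} [AddCommGroup V] [Module ℚ V] [FiniteDimensional ℚ V] [Nontrivial V]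
    (B : V →ₗ[ℚ] V →ₗ[ℚ] ℚ) (Φ : Set V) (h : IsPNRootLattice B Φ)
    (w : Module.End ℚ V) (l : List V) (hl : IsPres B Φ w l) :
    l.length = len B Φ w ↔ LinearIndependent ℚ l.get := by
  obtain ⟨hl1, rfl⟩ := hl
  constructor
  · intro hlen
    obtain ⟨l', h1, h2, h3⟩ := carter h _ l hl1 rfl
    have h4 : len B Φ (l.map (reflV B)).prod ≤ l'.length := Nat.sInf_le ⟨l', ⟨h1, h2⟩, rfl⟩
    have h5 := Submodule.finrank_mono (range_le (B := B) l)
    rw [linearIndependent_iff_card_le_finrank_span, Fintype.card_fin, Set.finrank]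
    omega
  · intro hli
    apply le_antisymm
    · have hne : {k | ∃ l' : List V, IsPres B Φ (l.map (reflV B)).prod l' ∧
          l'.length = k}.Nonempty := ⟨_, l, ⟨hl1, rfl⟩, rfl⟩
      refine le_csInf hne ?_
      rintro _ ⟨l', ⟨_, h2⟩, rfl⟩
      have h3 : span ℚ (Set.range l.get) ≤ LinearMap.range ((l.map (reflV B)).prod - 1) := by
        rw [span_le, Set.range_list_get]
        intro α hα
        exact mem_range_of_orth h _ (prod_isom h l hl1)
          (fun x hx => fix_orth h l hl1 hli x hx α hα)
      rw [← h2] at h3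
      have h4 := Submodule.finrank_mono (h3.trans (range_le l'))
      have h5 := finrank_range_le l'
      have h6 := finrank_span_eq_card hli
      rw [Fintype.card_fin] at h6
      omega
    · exact Nat.sInf_le ⟨l, ⟨hl1, rfl⟩, rfl⟩
end

section
/- Let (L,(·,·),Φ) be a homogeneous root lattice, i.e. a p.n. root lattice in which (α,α) takes the same value for all α ∈ Φ. Then all reduced presentations of one element w ∈ W have the same index: if L_1 and L_1' are the subroot lattices of two reduced presentations of w, then the finite groups (L ∩ (L_1 ⊗ ℚ))/L_1 and (L ∩ (L_1' ⊗ ℚ))/L_1' have the same cardinality. -/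
open Submodule

/-- The index of a presentation with subroot lattice `L₁ = span ℤ {α | α ∈ l}`:
the cardinality of `(L ∩ (L₁ ⊗ ℚ)) / L₁`, where `L = span ℤ Φ`. -/
noncomputable def presIndex {V : Type} [AddCommGroup V] [Module ℚ V]
    (Φ : Set V) (l : List V) : ℕ :=
  Nat.card
    ((↥(span ℤ Φ ⊓ (span ℚ {α | α ∈ l}).restrictScalars ℤ)) ⧸
      (comap (span ℤ Φ ⊓ (span ℚ {α | α ∈ l}).restrictScalars ℤ).subtype
        (span ℤ {α | α ∈ l})))


section helpers
variable {V : Type} [AddCommGroup V] [Module ℚ V]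

theorem reflV_apply (B : V →ₗ[ℚ] V →ₗ[ℚ] ℚ) (α x : V) :
    reflV B α x = x - (2 / B α α * B x α) • α := by
  simp [reflV]

/-- closed finite sets of roots of constant norm -/
structure SL (B : V →ₗ[ℚ] V →ₗ[ℚ] ℚ) (c : ℚ) (Ψ : Set V) : Prop where
  fin : Ψ.Finite
  symm : ∀ x y : V, B x y = B y x
  posdef : ∀ x : V, x ≠ 0 → 0 < B x x
  cpos : 0 < c
  norm : ∀ α ∈ Ψ, B α α = c
  int : ∀ α ∈ Ψ, ∀ β ∈ Ψ, ∃ z : ℤ, 2 * B α β = (z : ℚ) * c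
  refl : ∀ α ∈ Ψ, ∀ β ∈ Ψ, reflV B α β ∈ Ψ

/-- word of a list -/
noncomputable def wd (B : V →ₗ[ℚ] V →ₗ[ℚ] ℚ) (l : List V) : Module.End ℚ V :=
  (l.map (reflV B)).prod

variable {B : V →ₗ[ℚ] V →ₗ[ℚ] ℚ} {c : ℚ} {Ψ : Set V}

@[simp] theorem wd_nil : wd B [] = 1 := rfl
@[simp] theorem wd_cons (a : V) (l : List V) : wd B (a :: l) = reflV B a * wd B l := by
  simp [wd]
@[simp] theorem wd_append (l l' : List V) : wd B (l ++ l') = wd B l * wd B l' := by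
  simp [wd]

theorem reflV_neg (α : V) : reflV B (-α) = reflV B α := by
  ext x; simp [reflV_apply]

theorem SL.reflc (h : SL B c Ψ) {α : V} (hα : α ∈ Ψ) (x : V) :
    reflV B α x = x - (2 / c * B x α) • α := by
  rw [reflV_apply, h.norm α hα]

theorem SL.refl_self (h : SL B c Ψ) {α : V} (hα : α ∈ Ψ) : reflV B α α = -α := by
  have := h.cpos
  rw [h.reflc hα, h.norm α hα, div_mul_cancel₀ _ this.ne', two_smul]; abel

theorem SL.neg (h : SL B c Ψ) {α : V} (hα : α ∈ Ψ) : -α ∈ Ψ := by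
  rw [← h.refl_self hα]; exact h.refl _ hα _ hα

theorem SL.isom (h : SL B c Ψ) {α : V} (hα : α ∈ Ψ) (x y : V) :
    B (reflV B α x) (reflV B α y) = B x y := by
  have := h.cpos
  simp only [h.reflc hα, map_sub, map_smul, LinearMap.sub_apply, LinearMap.smul_apply,
    smul_eq_mul, h.norm α hα, h.symm α y]
  field_simp
  ring

theorem SL.invol (h : SL B c Ψ) {α : V} (hα : α ∈ Ψ) : reflV B α * reflV B α = 1 := by
  have := h.cpos
  ext x
  rw [Module.End.mul_apply, h.reflc hα (reflV B α x), h.reflc hα x]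
  simp only [map_sub, map_smul, LinearMap.sub_apply, LinearMap.smul_apply, smul_eq_mul,
    h.norm α hα, Module.End.one_apply]
  rw [sub_sub, ← add_smul]
  have : (2 / c * (B x) α + 2 / c * ((B x) α - 2 / c * (B x) α * c)) = 0 := by
    field_simp; ring
  rw [this]; simp

theorem SL.wd_isom (h : SL B c Ψ) {l : List V} (hl : ∀ a ∈ l, a ∈ Ψ) (x y : V) :
    B (wd B l x) (wd B l y) = B x y := by
  induction l with
  | nil => simp
  | cons a t ih =>
    simp only [List.mem_cons, forall_eq_or_imp] at hl
    simp only [wd_cons, Module.End.mul_apply]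
    rw [h.isom hl.1, ih hl.2]

theorem SL.wd_mem (h : SL B c Ψ) {l : List V} (hl : ∀ a ∈ l, a ∈ Ψ) {x : V} (hx : x ∈ Ψ) :
    wd B l x ∈ Ψ := by
  induction l with
  | nil => simpa
  | cons a t ih =>
    simp only [List.mem_cons, forall_eq_or_imp] at hl
    simp only [wd_cons, Module.End.mul_apply]
    exact h.refl _ hl.1 _ (ih hl.2)

theorem refl_conj {g : Module.End ℚ V} (hg : ∀ x y, B (g x) (g y) = B x y) (α : V) :
    reflV B (g α) * g = g * reflV B α := by
  ext x
  simp [reflV_apply, hg]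

theorem SL.tri (h : SL B c Ψ) {α β : V} (hα : α ∈ Ψ) (hβ : β ∈ Ψ) (h1 : α ≠ β) (h2 : α ≠ -β) :
    2 / c * B α β = 1 ∨ 2 / c * B α β = 0 ∨ 2 / c * B α β = -1 := by
  have hc := h.cpos
  obtain ⟨z, hz⟩ := h.int α hα β hβ
  have e1 := h.posdef (α - β) (sub_ne_zero.2 h1)
  have e2 := h.posdef (α + β) (by rwa [Ne, add_eq_zero_iff_eq_neg])
  simp only [map_sub, map_add, LinearMap.sub_apply, LinearMap.add_apply, h.norm α hα,
    h.norm β hβ, h.symm β α] at e1 e2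
  have e3 : (z : ℚ) * c < 2 * c := by linarith
  have e4 : (-2 : ℚ) * c < z * c := by linarith
  have e5 : (z : ℚ) < 2 := lt_of_mul_lt_mul_right e3 hc.le
  have e6 : (-2 : ℚ) < z := lt_of_mul_lt_mul_right e4 hc.le
  have e7 : z < 2 := by exact_mod_cast e5
  have e8 : -2 < z := by exact_mod_cast e6
  have e9 : 2 / c * B α β = z := by field_simp; linarith
  rw [e9]
  have : z = 1 ∨ z = 0 ∨ z = -1 := by omega
  rcases this with rfl | rfl | rfl <;> simp

/-- simple roots -/
def Simp_s3 (Ψ : Set V) (f : V →ₗ[ℚ] ℚ) (α : V) : Prop :=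
  α ∈ Ψ ∧ 0 < f α ∧ ∀ β ∈ Ψ, ∀ γ ∈ Ψ, 0 < f β → 0 < f γ → α ≠ β + γ

theorem SL.simple_perm (h : SL B c Ψ) {f : V →ₗ[ℚ] ℚ} (hf : ∀ α ∈ Ψ, f α ≠ 0) {α β : V}
    (hα : Simp_s3 Ψ f α) (hβ : β ∈ Ψ) (hp : 0 < f β) (hne : β ≠ α) : 0 < f (reflV B α β) := by
  obtain ⟨ha, hfa, hs⟩ := hα
  have hne2 : β ≠ -α := by
    rintro rfl; simp at hp; linarith
  rcases h.tri hβ ha hne hne2 with e | e | e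
  · by_contra hcon
    have hm := h.refl α ha β hβ
    have hlt : f (reflV B α β) < 0 := lt_of_le_of_ne (not_lt.1 hcon) (hf _ hm)
    refine hs β hβ _ (h.neg hm) hp (by simpa using hlt) ?_
    rw [h.reflc ha, e]; simp
  · rw [h.reflc ha, e]; simpa
  · rw [h.reflc ha, e]; simp; linarith

theorem SL.gen1 (h : SL B c Ψ) {f : V →ₗ[ℚ] ℚ} (hf : ∀ α ∈ Ψ, f α ≠ 0) {β : V}
    (hβ : β ∈ Ψ) (hp : 0 < f β) : ∃ l, (∀ a ∈ l, Simp_s3 Ψ f a) ∧ wd B l = reflV B β := by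
  by_contra hcon
  set bad : Set V := {β | β ∈ Ψ ∧ 0 < f β ∧ ¬ ∃ l, (∀ a ∈ l, Simp_s3 Ψ f a) ∧ wd B l = reflV B β}
    with hbad
  obtain ⟨b, ⟨hb, hbp, hbn⟩, hmin⟩ := Set.exists_min_image bad f
    (h.fin.subset fun x hx => hx.1) ⟨β, hβ, hp, hcon⟩
  have good : ∀ γ ∈ Ψ, 0 < f γ → f γ < f b →
      ∃ l, (∀ a ∈ l, Simp_s3 Ψ f a) ∧ wd B l = reflV B γ := by
    intro γ h1 h2 h3
    by_contra h4
    exact absurd (hmin γ ⟨h1, h2, h4⟩) (not_le.2 h3)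
  by_cases hs : Simp_s3 Ψ f b
  · exact hbn ⟨[b], by simpa using hs, by simp⟩
  · simp only [Simp_s3, hb, hbp, true_and, not_forall] at hs
    obtain ⟨γ, hγ, δ, hδ, pγ, pδ, e⟩ := hs
    simp only [ne_eq, not_not] at e
    have hfe : f b = f γ + f δ := by rw [e, map_add]
    obtain ⟨l1, h1, w1⟩ := good γ hγ pγ (by linarith)
    obtain ⟨l2, h2, w2⟩ := good δ hδ pδ (by linarith)
    have hc := h.cpos
    have hn := h.norm b hb
    rw [e] at hn
    simp only [map_add, LinearMap.add_apply, h.norm γ hγ, h.norm δ hδ, h.symm δ γ] at hn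
    have h3 : reflV B γ δ = b := by
      rw [h.reflc hγ, h.symm δ γ]
      have : 2 / c * B γ δ = -1 := by field_simp; linarith
      rw [this, e]; simp [add_comm]
    refine hbn ⟨l1 ++ (l2 ++ l1), ?_, ?_⟩
    · simp only [List.mem_append]; rintro a (ha | ha | ha)
      exacts [h1 a ha, h2 a ha, h1 a ha]
    · rw [wd_append, wd_append, w1, w2, ← h3, ← mul_assoc, ← refl_conj (h.isom hγ), mul_assoc,
        h.invol hγ, mul_one]

theorem SL.gen (h : SL B c Ψ) {f : V →ₗ[ℚ] ℚ} (hf : ∀ α ∈ Ψ, f α ≠ 0) {l : List V}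
    (hl : ∀ a ∈ l, a ∈ Ψ) : ∃ l', (∀ a ∈ l', Simp_s3 Ψ f a) ∧ wd B l' = wd B l := by
  induction l with
  | nil => exact ⟨[], by simp, rfl⟩
  | cons a t ih =>
    simp only [List.mem_cons, forall_eq_or_imp] at hl
    obtain ⟨t', h1, h2⟩ := ih hl.2
    have : ∃ l, (∀ a ∈ l, Simp_s3 Ψ f a) ∧ wd B l = reflV B a := by
      rcases lt_or_gt_of_ne (hf a hl.1) with hneg | hpos
      · rw [← reflV_neg]; exact h.gen1 hf (h.neg hl.1) (by simpa using hneg)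
      · exact h.gen1 hf hl.1 hpos
    obtain ⟨l1, h3, h4⟩ := this
    refine ⟨l1 ++ t', ?_, by simp [h2, h4]⟩
    simp only [List.mem_append]; rintro b (hb | hb)
    exacts [h3 b hb, h1 b hb]

theorem SL.exch (h : SL B c Ψ) {f : V →ₗ[ℚ] ℚ} (hf : ∀ α ∈ Ψ, f α ≠ 0) {l : List V}
    (hl : ∀ a ∈ l, Simp_s3 Ψ f a) {β : V} (hβ : β ∈ Ψ) (hp : 0 < f β) (hn : f (wd B l β) < 0) :
    ∃ l1 γ l2, l = l1 ++ γ :: l2 ∧ wd B l2 β = γ := by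
  induction l with
  | nil => simp at hn; linarith
  | cons a t ih =>
    simp only [List.mem_cons, forall_eq_or_imp] at hl
    have hm : wd B t β ∈ Ψ := h.wd_mem (fun b hb => (hl.2 b hb).1) hβ
    rcases lt_or_gt_of_ne (hf _ hm) with hneg | hpos
    · obtain ⟨l1, γ, l2, e1, e2⟩ := ih hl.2 hneg
      exact ⟨a :: l1, γ, l2, by simp [e1], e2⟩
    · refine ⟨[], a, t, rfl, ?_⟩
      by_contra hne
      have := h.simple_perm hf hl.1 hm hpos hne
      simp at hn; linarith

theorem SL.stab1 (h : SL B c Ψ) {f : V →ₗ[ℚ] ℚ} (hf : ∀ α ∈ Ψ, f α ≠ 0) {x : V}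
    (hx : ∀ α ∈ Ψ, 0 < f α → 0 ≤ B x α) (n : ℕ) : ∀ l : List V, l.length = n →
    (∀ a ∈ l, Simp_s3 Ψ f a) → wd B l x = x →
    ∃ l', (∀ a ∈ l', a ∈ Ψ ∧ B x a = 0) ∧ wd B l' = wd B l := by
  induction n using Nat.strong_induction_on with
  | _ n ih =>
  intro l hn hl hfix
  rcases List.eq_nil_or_concat l with rfl | ⟨t, α, rfl⟩
  · exact ⟨[], by simp, rfl⟩
  · simp only [List.concat_eq_append] at *
    have hα : Simp_s3 Ψ f α := hl α (by simp)
    have ht : ∀ a ∈ t, Simp_s3 Ψ f a := fun a ha => hl a (by simp [ha])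
    have hm : wd B t α ∈ Ψ := h.wd_mem (fun b hb => (ht b hb).1) hα.1
    rcases lt_or_gt_of_ne (hf _ hm) with hneg | hpos
    · obtain ⟨t1, γ, t2, rfl, e2⟩ := h.exch hf ht hα.1 hα.2.1 hneg
      have key : wd B (t1 ++ γ :: t2 ++ [α]) = wd B (t1 ++ t2) := by
        have h2 : ∀ a ∈ t2, a ∈ Ψ := fun a ha => (ht a (by simp [ha])).1
        have := refl_conj (h.wd_isom h2) α
        rw [e2] at this
        simp only [wd_append, wd_cons, wd_nil, mul_one]
        rw [this, mul_assoc, mul_assoc, h.invol hα.1, mul_one]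
      rw [key] at hfix ⊢
      refine ih (t1 ++ t2).length ?_ _ rfl ?_ hfix
      · rw [← hn]; simp
      · intro a ha; apply ht; simp at ha ⊢; tauto
    · have e1 : wd B (t ++ [α]) α = - wd B t α := by
        simp [h.refl_self hα.1]
      have e2 := h.wd_isom (l := t ++ [α]) (fun a ha => (hl a ha).1) x α
      rw [hfix, e1, map_neg] at e2
      have e3 := hx _ hm hpos
      have e4 := hx _ hα.1 hα.2.1
      have e5 : B x α = 0 := by linarith
      have e6 : reflV B α x = x := by rw [reflV_apply, e5]; simp
      have e7 : wd B t x = x := by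
        simpa [e6] using hfix
      obtain ⟨l', g1, g2⟩ := ih t.length (by rw [← hn]; simp) t rfl ht e7
      refine ⟨l' ++ [α], ?_, by simp [g2]⟩
      intro a ha
      simp at ha
      rcases ha with ha | rfl
      exacts [g1 a ha, ⟨hα.1, e5⟩]

theorem SL.stab (h : SL B c Ψ) {x : V} {l : List V} (hl : ∀ a ∈ l, a ∈ Ψ) (hfix : wd B l x = x) :
    ∃ l', (∀ a ∈ l', a ∈ Ψ ∧ B x a = 0) ∧ wd B l' = wd B l := by
  obtain ⟨f, hf, hx⟩ : ∃ f : V →ₗ[ℚ] ℚ, (∀ α ∈ Ψ, f α ≠ 0) ∧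
      (∀ α ∈ Ψ, 0 < f α → 0 ≤ B x α) := by
    have := h.fin.to_subtype
    obtain ⟨q, hq⟩ := Module.exists_dual_forall_apply_ne_zero (K := ℚ) (fun i : Ψ => (i : V)) (by
      rintro ⟨a, ha⟩ rfl
      have := h.norm _ ha
      have := h.cpos
      simp at *; linarith)
    obtain ⟨N, hN⟩ : ∃ N : ℚ, ∀ α ∈ Ψ, |q α| / |B x α| < N := by
      obtain ⟨N, hN⟩ := (h.fin.image (fun α => |q α| / |B x α|)).bddAbove
      exact ⟨N + 1, fun α hα => lt_of_le_of_lt (hN ⟨α, hα, rfl⟩) (by linarith)⟩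
    have hq' : ∀ α ∈ Ψ, q α ≠ 0 := fun α hα => hq ⟨α, hα⟩
    refine ⟨N • B x + q, ?_, ?_⟩
    · intro α hα
      simp only [LinearMap.add_apply, LinearMap.smul_apply, smul_eq_mul]
      intro e
      by_cases h0 : B x α = 0
      · rw [h0] at e; simp at e; exact hq' α hα e
      · have h1 := hN α hα
        rw [div_lt_iff₀ (abs_pos.2 h0)] at h1
        have h2 : q α = -(N * B x α) := by linarith
        rw [h2, abs_neg, abs_mul] at h1
        have h3 := lt_of_mul_lt_mul_right h1 (abs_nonneg _)
        have := hN α hα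
        have h5 : 0 ≤ |q α| / |B x α| := by positivity
        rw [abs_of_nonneg (by linarith)] at h3
        linarith
    · intro α hα
      simp only [LinearMap.add_apply, LinearMap.smul_apply, smul_eq_mul]
      intro e
      by_contra h0
      push Not at h0
      have h1 := hN α hα
      rw [div_lt_iff₀ (abs_pos.2 h0.ne), abs_of_neg h0] at h1
      have := le_abs_self (q α)
      linarith
  obtain ⟨l', h1, h2⟩ := h.gen hf hl
  rw [← h2] at hfix ⊢
  exact h.stab1 hf hx _ l' rfl h1 hfix

theorem SL.sub (h : SL B c Ψ) (x : V) : SL B c {a | a ∈ Ψ ∧ B x a = 0} where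
  fin := h.fin.subset fun a ha => ha.1
  symm := h.symm
  posdef := h.posdef
  cpos := h.cpos
  norm := fun a ha => h.norm a ha.1
  int := fun a ha b hb => h.int a ha.1 b hb.1
  refl := fun a ha b hb => ⟨h.refl a ha.1 b hb.1, by
    rw [reflV_apply]; simp [ha.2, hb.2]⟩

theorem SL.surj [FiniteDimensional ℚ V] (h : SL B c Ψ) : Function.Surjective B := by
  have hinj : Function.Injective B := by
    rw [injective_iff_map_eq_zero]
    intro a ha
    by_contra h0
    have := h.posdef a h0
    simp [ha] at this
  exact (LinearMap.injective_iff_surjective_of_finrank_eq_finrank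
      (Subspace.dual_finrank_eq (K := ℚ) (V := V)).symm).1 hinj

theorem SL.mem_range [FiniteDimensional ℚ V] (h : SL B c Ψ) {l : List V} (hl : ∀ a ∈ l, a ∈ Ψ)
    {α : V} (hα : ∀ x, wd B l x = x → B x α = 0) : ∃ x, x - wd B l x = α := by
  by_contra hcon
  have hn : α ∉ LinearMap.range (1 - wd B l) := by
    rintro ⟨x, hx⟩; exact hcon ⟨x, by simpa using hx⟩
  obtain ⟨f, hf1, hf2⟩ := Submodule.exists_le_ker_of_notMem hn
  obtain ⟨y, rfl⟩ := h.surj f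
  have h1 : ∀ z, B y (wd B l z) = B y z := by
    intro z
    have := hf2 ⟨z, rfl⟩
    simp at this
    linarith
  refine hf1 (hα y ?_)
  by_contra h0
  have h2 := h.posdef (wd B l y - y) (sub_ne_zero.2 h0)
  simp only [map_sub, LinearMap.sub_apply, h.wd_isom hl, h1, h.symm (wd B l y) y] at h2
  simp at h2

theorem SL.carter [FiniteDimensional ℚ V] (n : ℕ) : ∀ Ψ : Set V, SL B c Ψ → Ψ.ncard = n →
    ∀ l : List V, (∀ a ∈ l, a ∈ Ψ) → ∃ l', (∀ a ∈ l', a ∈ Ψ) ∧ wd B l' = wd B l ∧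
      l'.length + Module.finrank ℚ (LinearMap.ker (wd B l - 1)) ≤ Module.finrank ℚ V := by
  induction n using Nat.strong_induction_on with
  | _ n ih =>
  intro Ψ h hn l hl
  have case1 : ∀ l : List V, (∀ a ∈ l, a ∈ Ψ) → ∀ x, wd B l x = x → (∃ a ∈ Ψ, B x a ≠ 0) →
      ∃ l', (∀ a ∈ l', a ∈ Ψ) ∧ wd B l' = wd B l ∧
      l'.length + Module.finrank ℚ (LinearMap.ker (wd B l - 1)) ≤ Module.finrank ℚ V := by
    rintro l hl x hx ⟨a, ha, hxa⟩
    obtain ⟨l1, h1, h2⟩ := h.stab hl hx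
    have hlt : ({a | a ∈ Ψ ∧ B x a = 0} : Set V).ncard < n := by
      rw [← hn]
      apply Set.ncard_lt_ncard _ h.fin
      refine ⟨fun a ha => ha.1, fun hh => hxa (hh ha).2⟩
    obtain ⟨l2, h3, h4, h5⟩ := ih _ hlt _ (h.sub x) rfl l1 h1
    refine ⟨l2, fun a ha => (h3 a ha).1, h4.trans h2, ?_⟩
    rwa [h2] at h5
  by_cases hx : ∃ x, wd B l x = x ∧ ∃ a ∈ Ψ, B x a ≠ 0
  · obtain ⟨x, hx, ha⟩ := hx
    exact case1 l hl x hx ha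
  push Not at hx
  rcases Ψ.eq_empty_or_nonempty with rfl | ⟨α, hα⟩
  · refine ⟨l, hl, rfl, ?_⟩
    have : l = [] := List.eq_nil_iff_forall_not_mem.2 fun a ha => hl a ha
    subst this
    have := Submodule.finrank_le (LinearMap.ker (wd B ([] : List V) - 1))
    rw [List.length_nil, zero_add]
    exact this
  · obtain ⟨x, hxα⟩ := h.mem_range hl (fun x hxx => hx x hxx α hα)
    have hc := h.cpos
    have hw : wd B l x = x - α := by rw [← hxα]; abel
    have h1 := h.wd_isom hl x x
    rw [hw] at h1
    simp only [map_sub, LinearMap.sub_apply, h.norm α hα, h.symm α x] at h1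
    have hxa : B x α ≠ 0 := by intro e; rw [e] at h1; linarith
    have hs : reflV B α x = x - α := by
      rw [h.reflc hα]
      have : 2 / c * B x α = 1 := by field_simp; linarith
      rw [this, one_smul]
    have hfx : wd B (α :: l) x = x := by
      rw [wd_cons, Module.End.mul_apply, hw, ← hs, ← Module.End.mul_apply, h.invol hα]; rfl
    have hl2 : ∀ a ∈ α :: l, a ∈ Ψ := by simpa using ⟨hα, hl⟩
    obtain ⟨l', g1, g2, g3⟩ := case1 (α :: l) hl2 x hfx ⟨α, hα, hxa⟩
    refine ⟨α :: l', by simpa using ⟨hα, g1⟩, ?_, ?_⟩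
    · rw [wd_cons, g2, wd_cons, ← mul_assoc, h.invol hα, one_mul]
    · have hlt : LinearMap.ker (wd B l - 1) < LinearMap.ker (wd B (α :: l) - 1) := by
        refine ⟨?_, ?_⟩
        · intro y hy
          simp only [LinearMap.mem_ker, LinearMap.sub_apply, Module.End.one_apply,
            sub_eq_zero] at hy ⊢
          rw [wd_cons, Module.End.mul_apply, hy, h.reflc hα, hx y hy α hα]; simp
        · intro hh
          have : x ∈ LinearMap.ker (wd B (α :: l) - 1) := by
            simp only [LinearMap.mem_ker, LinearMap.sub_apply, Module.End.one_apply, sub_eq_zero]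
            exact hfx
          have h5 := hh this
          simp only [LinearMap.mem_ker, LinearMap.sub_apply, Module.End.one_apply,
            sub_eq_zero] at h5
          exact hxa (hx x h5 α hα)
      have := Submodule.finrank_lt_finrank_of_lt hlt
      simp only [List.length_cons]
      omega

theorem range_sub (l : List V) : LinearMap.range (wd B l - 1) ≤ span ℚ {a | a ∈ l} := by
  induction l with
  | nil => rintro _ ⟨x, rfl⟩; simp
  | cons a t ih =>
    rintro _ ⟨x, rfl⟩
    have h1 : wd B t x - x ∈ span ℚ {b | b ∈ a :: t} :=
      span_mono (fun b (hb : b ∈ t) => List.mem_cons_of_mem a hb) (ih ⟨x, rfl⟩)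
    have h2 : a ∈ span ℚ {b | b ∈ a :: t} := subset_span (by simp)
    have h3 : (wd B (a :: t) - 1) x
        = (wd B t x - x) - (2 / B a a * B (wd B t x) a) • a := by
      simp only [wd_cons, LinearMap.sub_apply, Module.End.mul_apply, Module.End.one_apply]
      rw [reflV_apply]; abel
    rw [h3]
    exact sub_mem h1 (smul_mem _ _ h2)

theorem range_eq {k : ℕ} (v : Fin k → V) : {a | a ∈ List.ofFn v} = Set.range v := by
  ext x; simp [List.mem_ofFn]

theorem SL.reduced [FiniteDimensional ℚ V] (h : SL B c Ψ) {k : ℕ} {v : Fin k → V}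
    (hl : ∀ i, v i ∈ Ψ)
    (hmin : ∀ l' : List V, (∀ a ∈ l', a ∈ Ψ) → wd B l' = wd B (List.ofFn v) → k ≤ l'.length) :
    LinearIndependent ℚ v ∧
      span ℚ (Set.range v) = LinearMap.range (wd B (List.ofFn v) - 1) := by
  obtain ⟨l', h1, h2, h3⟩ := SL.carter _ Ψ h rfl (List.ofFn v) (by simpa [List.mem_ofFn] using hl)
  have h4 := hmin l' h1 h2
  have h5 := LinearMap.finrank_range_add_finrank_ker (wd B (List.ofFn v) - 1)
  have h6 : Module.finrank ℚ (span ℚ (Set.range v)) ≤ k := by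
    have := finrank_range_le_card (R := ℚ) v
    rw [Fintype.card_fin] at this
    exact this
  have h0 := range_sub (B := B) (List.ofFn v)
  rw [range_eq] at h0
  have h7 := Submodule.finrank_mono h0
  refine ⟨?_, ?_⟩
  · rw [linearIndependent_iff_card_eq_finrank_span, Set.finrank, Fintype.card_fin]
    omega
  · exact (Submodule.eq_of_le_of_finrank_le h0 (by omega)).symm

theorem SL.tmat (h : SL B c Ψ) (k : ℕ) : ∀ v : Fin k → V, (∀ i, v i ∈ Ψ) →
    ∃ T : Matrix (Fin k) (Fin k) ℚ, T.det = 1 ∧ ∀ x, x - wd B (List.ofFn v) x =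
      ∑ i, (∑ j, T i j * (2 / c * B x (v j))) • v i := by
  induction k with
  | zero => intro v _; exact ⟨1, by simp, by simp⟩
  | succ k ih =>
    intro v hv
    obtain ⟨T, hT, hx⟩ := ih (fun i => v i.succ) (fun i => hv _)
    refine ⟨Matrix.of (Fin.cons (Fin.cons 1 fun j => - ∑ i, (2 / c * B (v (Fin.succ i)) (v 0)) * T i j)
      (fun i => Fin.cons 0 (T i))), ?_, ?_⟩
    · rw [Matrix.det_succ_column_zero, Fin.sum_univ_succ]
      simp only [Matrix.of_apply, Fin.cons_zero, Fin.cons_succ]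
      simp only [mul_zero, zero_mul, Finset.sum_const_zero, add_zero]
      rw [Fin.val_zero, pow_zero, one_mul, one_mul]
      rw [← hT]
      congr 1
    · intro x
      have e := hx x
      set y := wd B (List.ofFn fun i => v i.succ) x with hy
      rw [List.ofFn_succ, wd_cons, Module.End.mul_apply, ← hy, h.reflc (hv 0)]
      have e2 : y = x - ∑ i : Fin k, (∑ j : Fin k, T i j * (2 / c * B x (v j.succ))) • v i.succ := by
        rw [← e]; abel
      have e3 : B y (v 0) = B x (v 0) -
          ∑ i : Fin k, (∑ j : Fin k, T i j * (2 / c * B x (v j.succ))) * B (v i.succ) (v 0) := by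
        rw [e2]; simp [LinearMap.sum_apply]
      rw [Fin.sum_univ_succ]
      simp only [Matrix.of_apply, Fin.cons_zero, Fin.cons_succ, Fin.sum_univ_succ, zero_mul,
        zero_add, one_mul]
      rw [← e]
      have e4 : 2 / c * B x (v 0) + ∑ j : Fin k, (-∑ i, (2 / c * B (v (Fin.succ i)) (v 0)) * T i j)
          * (2 / c * B x (v j.succ)) = 2 / c * B y (v 0) := by
        rw [e3, mul_sub, sub_eq_add_neg, Finset.mul_sum, ← Finset.sum_neg_distrib]
        congr 1
        simp only [neg_mul, Finset.sum_mul, Finset.mul_sum, Finset.sum_neg_distrib]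
        rw [Finset.sum_comm]
        congr 1
        refine Finset.sum_congr rfl fun i _ => Finset.sum_congr rfl fun j _ => ?_
        ring
      rw [e4]; abel

theorem SL.detP [FiniteDimensional ℚ V] (h : SL B c Ψ) {k : ℕ} {v v' : Fin k → V}
    (hv : ∀ i, v i ∈ Ψ) (hv' : ∀ i, v' i ∈ Ψ) (hli : LinearIndependent ℚ v)
    (hw : wd B (List.ofFn v) = wd B (List.ofFn v')) {P : Matrix (Fin k) (Fin k) ℚ}
    (hP : ∀ j, v' j = ∑ i, P i j • v i) : |P.det| = 1 := by
  have hc := h.cpos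
  obtain ⟨T, hT, hx⟩ := h.tmat k v hv
  obtain ⟨T', hT', hx'⟩ := h.tmat k v' hv'
  have key : T = P * T' * P.transpose := by
    apply Matrix.mulVec_injective
    funext u
    obtain ⟨x, hxu⟩ : ∃ x, ∀ j, 2 / c * B x (v j) = u j := by
      obtain ⟨g, hg⟩ := LinearMap.exists_extend
        ((Module.Basis.span hli).constr ℚ (fun j => c / 2 * u j))
      obtain ⟨x, rfl⟩ := h.surj g
      refine ⟨x, fun j => ?_⟩
      have := LinearMap.congr_fun hg (Module.Basis.span hli j)
      rw [Module.Basis.constr_basis] at this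
      simp [Module.Basis.span_apply] at this
      rw [this]; field_simp
    have h1 := hx x
    have h2 := hx' x
    rw [hw, h2] at h1
    have hB : ∀ j, 2 / c * B x (v' j) = P.transpose.mulVec u j := by
      intro j
      rw [hP j, Matrix.mulVec, dotProduct]
      simp only [map_sum, map_smul, smul_eq_mul, Finset.mul_sum, Matrix.transpose_apply, ← hxu]
      refine Finset.sum_congr rfl fun i _ => by ring
    have h3 : ∀ i, ∑ j, T' i j * (2 / c * B x (v' j)) = T'.mulVec (P.transpose.mulVec u) i := by
      intro i; simp only [hB]; rfl
    have h4 : ∀ i, ∑ j, T i j * (2 / c * B x (v j)) = T.mulVec u i := by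
      intro i; simp only [hxu]; rfl
    simp only [h3, h4] at h1
    set z := T'.mulVec (P.transpose.mulVec u) with hz
    have h5 : ∑ i, z i • v' i = ∑ i, P.mulVec z i • v i := by
      simp only [hP, Finset.smul_sum, Matrix.mulVec, dotProduct, Finset.sum_smul]
      rw [Finset.sum_comm]
      refine Finset.sum_congr rfl fun i _ => Finset.sum_congr rfl fun j _ => ?_
      rw [smul_smul, mul_comm]
    rw [h5] at h1
    have h6 : ∑ i, (P.mulVec z i - T.mulVec u i) • v i = 0 := by
      simp only [sub_smul, Finset.sum_sub_distrib, h1, sub_self]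
    have h7 := Fintype.linearIndependent_iff.1 hli _ h6
    rw [← Matrix.mulVec_mulVec, ← Matrix.mulVec_mulVec, ← hz]
    funext i
    have := h7 i
    linarith
  have := congrArg Matrix.det key
  rw [Matrix.det_mul, Matrix.det_mul, Matrix.det_transpose, hT, hT', mul_one] at this
  rcases mul_self_eq_one_iff.1 this.symm with h | h <;> simp [h]

theorem index_det {k : ℕ} (M : Submodule ℤ V) (e : Module.Basis (Fin k) ℤ M) {v : Fin k → V}
    (hv : ∀ i, v i ∈ M) (hli : LinearIndependent ℚ v) :
    Nat.card (M ⧸ comap M.subtype (span ℤ (Set.range v))) =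
      (e.det fun i => ⟨v i, hv i⟩).natAbs := by
  have hli2 : LinearIndependent ℤ (fun i => (⟨v i, hv i⟩ : M)) := by
    have h1 : LinearIndependent ℤ v := hli.restrict_scalars' ℤ
    exact LinearIndependent.of_comp M.subtype h1
  have hN : comap M.subtype (span ℤ (Set.range v)) = span ℤ (Set.range fun i => (⟨v i, hv i⟩ : M)) := by
    apply Submodule.map_injective_of_injective M.injective_subtype
    rw [Submodule.map_span, Submodule.map_comap_eq, ← Set.range_comp]
    rw [Submodule.range_subtype, inf_eq_right.2]
    · rfl
    · rw [span_le]; rintro _ ⟨i, rfl⟩; exact hv i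
  have : Module.Free ℤ M := Module.Free.of_basis e
  have : Module.Finite ℤ M := Module.Finite.of_basis e
  rw [hN]
  have := Submodule.natAbs_det_basis_change e _ (Module.Basis.span hli2)
  rw [← this]
  congr 2
  funext i
  simp [Module.Basis.span_apply]

theorem exists_basis [FiniteDimensional ℚ V] {k : ℕ} (M : Submodule ℤ V) [Module.Finite ℤ M] {v : Fin k → V}
    (hv : ∀ i, v i ∈ M) (hli : LinearIndependent ℚ v) (hM : ∀ x ∈ M, x ∈ span ℚ (Set.range v)) :
    Nonempty (Module.Basis (Fin k) ℤ M) := by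
  have : IsAddTorsionFree V := IsAddTorsionFree.of_module_rat V
  have hfree : Module.Free ℤ M := inferInstance
  have e := Module.finBasis ℤ M
  have hli2 : LinearIndependent ℤ (fun i => (⟨v i, hv i⟩ : M)) := by
    have h1 : LinearIndependent ℤ v := hli.restrict_scalars' ℤ
    exact LinearIndependent.of_comp M.subtype h1
  have h1 := hli2.fintype_card_le_finrank
  have h2 : LinearIndependent ℤ (fun i => (e i : V)) :=
    e.linearIndependent.map' M.subtype (by simp)
  rw [LinearIndependent.iff_fractionRing ℤ ℚ] at h2
  have h3 : span ℚ (Set.range fun i => (e i : V)) ≤ span ℚ (Set.range v) := by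
    rw [span_le]; rintro _ ⟨i, rfl⟩; exact hM _ (e i).2
  have h4 := Submodule.finrank_mono h3
  rw [finrank_span_eq_card h2, finrank_span_eq_card hli] at h4
  simp only [Fintype.card_fin] at h1 h4
  have h5 : Module.finrank ℤ M = k := le_antisymm h4 h1
  exact ⟨e.reindex (finCongr h5)⟩

theorem det_compare {k : ℕ} (M : Submodule ℤ V) (e : Module.Basis (Fin k) ℤ M) {v v' : Fin k → V}
    (hv : ∀ i, v i ∈ M) (hv' : ∀ i, v' i ∈ M) {P : Matrix (Fin k) (Fin k) ℚ}
    (hP : ∀ j, v' j = ∑ i, P i j • v i) (hd : |P.det| = 1) :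
    (e.det fun i => ⟨v i, hv i⟩).natAbs = (e.det fun i => ⟨v' i, hv' i⟩).natAbs := by
  have h2 : LinearIndependent ℤ (fun i => (e i : V)) :=
    e.linearIndependent.map' M.subtype (by simp)
  rw [LinearIndependent.iff_fractionRing ℤ ℚ] at h2
  have hrep : ∀ x : M, (x : V) = ∑ m, (e.repr x m : ℚ) • (e m : V) := by
    intro x
    conv_lhs => rw [← e.sum_repr x]
    simp only [AddSubmonoidClass.coe_finsetSum, Submodule.coe_smul, Int.cast_smul_eq_zsmul]
  set A := e.toMatrix fun i => (⟨v i, hv i⟩ : M) with hA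
  set A' := e.toMatrix fun i => (⟨v' i, hv' i⟩ : M) with hA'
  have key : A'.map (Int.castRingHom ℚ) = A.map (Int.castRingHom ℚ) * P := by
    ext m j
    have h3 : ∑ m, ((A' m j : ℚ) - ∑ i, (A m i : ℚ) * P i j) • (e m : V) = 0 := by
      simp only [sub_smul, Finset.sum_sub_distrib, Finset.sum_smul]
      rw [sub_eq_zero, Finset.sum_comm]
      refine (hrep ⟨v' j, hv' j⟩).symm.trans ?_
      refine (hP j).trans (Finset.sum_congr rfl fun i _ => ?_)
      have := hrep ⟨v i, hv i⟩
      simp only at this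
      rw [this, Finset.smul_sum]
      refine Finset.sum_congr rfl fun m _ => ?_
      rw [smul_smul, mul_comm]; rfl
    have := Fintype.linearIndependent_iff.1 h2 _ h3 m
    simp only [Matrix.map_apply, Matrix.mul_apply, eq_intCast]
    linarith
  have hdet := congrArg (fun X => |Matrix.det X|) key
  simp only [Matrix.det_mul, abs_mul, hd, mul_one] at hdet
  rw [← RingHom.mapMatrix_apply, ← RingHom.mapMatrix_apply, ← RingHom.map_det,
    ← RingHom.map_det] at hdet
  simp only [eq_intCast] at hdet
  rw [Module.Basis.det_apply, Module.Basis.det_apply, ← hA, ← hA']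
  have : |A'.det| = |A.det| := by exact_mod_cast hdet
  exact (Int.natAbs_eq_natAbs_iff.2 (abs_eq_abs.1 this)).symm

theorem exists_ofFn {k : ℕ} (l : List V) (hl : l.length = k) : ∃ v : Fin k → V, l = List.ofFn v := by
  subst hl
  exact ⟨l.get, (List.ofFn_get l).symm⟩

theorem IsPNRootLattice.toSL {Φ : Set V} (h : IsPNRootLattice B Φ)
    (hhom : ∀ α ∈ Φ, ∀ β ∈ Φ, B α α = B β β) : ∃ c, SL B c Φ := by
  obtain ⟨α, hα⟩ := h.nonempty
  refine ⟨B α α, h.finite, h.symm, h.posdef, h.posdef _ (h.ne_zero α hα),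
    fun β hβ => hhom _ hβ _ hα, fun β hβ γ hγ => ?_, fun β hβ γ hγ => ?_⟩
  · rw [hhom α hα γ hγ]; exact h.pair_int γ hγ β hβ
  · rw [← h.refl_maps β hβ]
    refine ⟨γ, hγ, ?_⟩
    rw [reflV_apply]
    simp only [div_mul_eq_mul_div]

end helpers

/-- In a homogeneous root lattice, all reduced presentations of one Weyl group element
have the same index. -/
theorem stmt3 {V : Type} [AddCommGroup V] [Module ℚ V] [FiniteDimensional ℚ V] [Nontrivial V]
    (B : V →ₗ[ℚ] V →ₗ[ℚ] ℚ) (Φ : Set V) (h : IsPNRootLattice B Φ)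
    (hhom : ∀ α ∈ Φ, ∀ β ∈ Φ, B α α = B β β)
    (w : Module.End ℚ V) (l l' : List V)
    (hl : IsPres B Φ w l) (hl' : IsPres B Φ w l')
    (hred : l.length = len B Φ w) (hred' : l'.length = len B Φ w) :
    presIndex Φ l = presIndex Φ l' := by
  obtain ⟨c, hs⟩ := h.toSL hhom
  have hmin : ∀ l'' : List V, (∀ a ∈ l'', a ∈ Φ) → wd B l'' = w → len B Φ w ≤ l''.length :=
    fun l'' h1 h2 => Nat.sInf_le ⟨l'', ⟨h1, h2⟩, rfl⟩
  obtain ⟨hl1, hl2⟩ := hl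
  obtain ⟨hl1', hl2'⟩ := hl'
  change wd B l = w at hl2
  change wd B l' = w at hl2'
  generalize len B Φ w = k at *
  obtain ⟨v, rfl⟩ := exists_ofFn l hred
  obtain ⟨v', rfl⟩ := exists_ofFn l' hred'
  have hv : ∀ i, v i ∈ Φ := fun i => hl1 _ (by simp [List.mem_ofFn])
  have hv' : ∀ i, v' i ∈ Φ := fun i => hl1' _ (by simp [List.mem_ofFn])
  obtain ⟨li, sp⟩ := hs.reduced hv (by rw [hl2]; exact hmin)
  obtain ⟨li', sp'⟩ := hs.reduced hv' (by rw [hl2']; exact hmin)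
  rw [hl2] at sp
  rw [hl2', ← sp] at sp'
  unfold presIndex
  rw [range_eq, range_eq, sp']
  set M := span ℤ Φ ⊓ (span ℚ (Set.range v)).restrictScalars ℤ with hM
  have hvM : ∀ i, v i ∈ M := fun i => ⟨subset_span (hv i), subset_span ⟨i, rfl⟩⟩
  have hvM' : ∀ i, v' i ∈ M := fun i => ⟨subset_span (hv' i), by
    change v' i ∈ span ℚ (Set.range v)
    rw [← sp']; exact subset_span ⟨i, rfl⟩⟩
  have hfin : Module.Finite ℤ (span ℤ Φ) := Module.Finite.span_of_finite ℤ h.finite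
  have hfinM : Module.Finite ℤ M :=
    Module.Finite.of_injective (Submodule.inclusion (inf_le_left : M ≤ span ℤ Φ))
      (Submodule.inclusion_injective _)
  obtain ⟨e⟩ := exists_basis M hvM li (fun x hx => hx.2)
  have hP : ∀ j, ∃ p : Fin k → ℚ, ∑ i, p i • v i = v' j := by
    intro j
    exact (Submodule.mem_span_range_iff_exists_fun ℚ).1 (hvM' j).2
  choose p hp using hP
  have hP : ∀ j, v' j = ∑ i, (Matrix.of fun i j => p j i) i j • v i := fun j => (hp j).symm
  rw [index_det M e hvM li, index_det M e hvM' li']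
  exact det_compare M e hvM hvM' hP (hs.detP hv hv' li (hl2.trans hl2'.symm) hP)
end

section
/- Let n ≥ 1, let L = ℤ^n and Φ be the p.n. root system of type BC_n with Weyl group W. Then W contains no strict quasi Coxeter element: for every w ∈ W there exists a reduced presentation of w whose subroot lattice is a proper ℤ-submodule of ℤ^n. -/
/-- The standard basis vector `e i` of `ℤ^m`. -/
def std (m : ℕ) (i : Fin m) : Fin m → ℤ := Pi.single i 1

/-- The p.n. root system of type `BC_n`:
`{± e_i} ∪ {± e_i ± e_j | i < j} ∪ {± 2 e_i}` in `ℤ^n`. -/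
def PhiBC (n : ℕ) : Set (Fin n → ℤ) :=
  {v | ∃ i : Fin n, v = std n i ∨ v = -std n i} ∪
  {v | ∃ i j : Fin n, i ≠ j ∧
    (v = std n i - std n j ∨ v = std n i + std n j ∨ v = -(std n i + std n j))} ∪
  {v | ∃ i : Fin n, v = (2 : ℤ) • std n i ∨ v = -((2 : ℤ) • std n i)}

/-- The standard scalar product on `ℤ^m`. -/
def dotZ {m : ℕ} (x y : Fin m → ℤ) : ℤ := ∑ i, x i * y i

/-- The reflection `s_α : x ↦ x - (2(x,α)/(α,α)) • α` (the division is exact for every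
root `α` of the systems considered here, so this is the honest reflection). -/
def reflZ {m : ℕ} (α : Fin m → ℤ) (x : Fin m → ℤ) : Fin m → ℤ :=
  x - ((2 * dotZ x α) / dotZ α α) • α

/-- The signed permutation determined by `σ` and signs `ε`, i.e. the ℤ-linear map with
`w(e_i) = ε_i • e_{σ(i)}`. -/
def wSigned {n : ℕ} (σ : Equiv.Perm (Fin n)) (ε : Fin n → ℤ) :
    (Fin n → ℤ) → (Fin n → ℤ) :=
  fun x j => ε (σ⁻¹ j) * x (σ⁻¹ j)

/-- `(α_1, …, α_k)` is a presentation of `w`: all `α_i` are roots and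
`w = s_{α_1} ∘ ⋯ ∘ s_{α_k}`. -/
def IsPresZ {m : ℕ} (Φ : Set (Fin m → ℤ)) (w : (Fin m → ℤ) → (Fin m → ℤ))
    (l : List (Fin m → ℤ)) : Prop :=
  (∀ α ∈ l, α ∈ Φ) ∧ l.foldr (fun α f => reflZ α ∘ f) id = w

/-- The length `l(w)`: the minimal length of a presentation of `w`. -/
noncomputable def clen {m : ℕ} (Φ : Set (Fin m → ℤ))
    (w : (Fin m → ℤ) → (Fin m → ℤ)) : ℕ :=
  sInf {k | ∃ l, IsPresZ Φ w l ∧ l.length = k}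

lemma sum_std (n : ℕ) (i : Fin n) : ∑ k, std n i k = 1 := by
  simp [std]

lemma dot_std {n : ℕ} (x : Fin n → ℤ) (i : Fin n) : dotZ x (std n i) = x i := by
  simp [dotZ, std, Pi.single_apply]

lemma dot_smul {n : ℕ} (x y : Fin n → ℤ) (c : ℤ) : dotZ x (c • y) = c * dotZ x y := by
  simp only [dotZ, Finset.mul_sum, Pi.smul_apply, smul_eq_mul]
  exact Finset.sum_congr rfl fun _ _ => by ring

lemma refl_smul_std {n : ℕ} (i : Fin n) (c : ℤ) (hc : c = -1 ∨ c = 1 ∨ c = 2) :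
    reflZ (c • std n i) = reflZ ((2 : ℤ) • std n i) := by
  funext x
  have h1 : std n i i = 1 := by simp [std]
  unfold reflZ
  simp only [dot_smul, dot_std, Pi.smul_apply, smul_eq_mul, h1, smul_smul]
  have h2 : 2 * (2 * x i) / (2 * (2 * 1)) = x i := by omega
  rw [h2]
  congr 2
  rcases hc with rfl | rfl | rfl <;> omega

lemma even_root {n : ℕ} (α : Fin n → ℤ) (h : α ∈ PhiBC n) :
    ∃ β ∈ PhiBC n, reflZ β = reflZ α ∧ Even (∑ k, β k) := by
  rcases h with (⟨i, h⟩ | ⟨i, j, hij, h⟩) | ⟨i, h⟩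
  · refine ⟨(2 : ℤ) • std n i, Or.inr ⟨i, Or.inl rfl⟩, ?_, ?_⟩
    · rcases h with rfl | rfl
      · simpa using (refl_smul_std i 1 (by simp)).symm
      · simpa using (refl_smul_std i (-1) (by simp)).symm
    · simp [← Finset.mul_sum]
  · refine ⟨α, Or.inl (Or.inr ⟨i, j, hij, h⟩), rfl, ?_⟩
    rcases h with rfl | rfl | rfl <;>
      simp [Finset.sum_add_distrib, Finset.sum_sub_distrib, sum_std] <;> decide
  · refine ⟨α, Or.inr ⟨i, h⟩, rfl, ?_⟩
    rcases h with rfl | rfl <;> simp [← Finset.mul_sum]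

lemma even_list {n : ℕ} (l : List (Fin n → ℤ)) (h : ∀ α ∈ l, α ∈ PhiBC n) :
    ∃ l' : List (Fin n → ℤ), l'.length = l.length ∧ (∀ α ∈ l', α ∈ PhiBC n) ∧
      l'.foldr (fun α f => reflZ α ∘ f) id = l.foldr (fun α f => reflZ α ∘ f) id ∧
      ∀ α ∈ l', Even (∑ k, α k) := by
  induction l with
  | nil => exact ⟨[], by simp⟩
  | cons a t ih =>
    obtain ⟨l', h1, h2, h3, h4⟩ := ih fun α hα => h α (List.mem_cons_of_mem _ hα)
    obtain ⟨β, hb, hr, he⟩ := even_root a (h a List.mem_cons_self)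
    refine ⟨β :: l', by simp [h1], ?_, ?_, ?_⟩
    · simpa using ⟨hb, h2⟩
    · simp only [List.foldr_cons, h3, hr]
    · simpa using ⟨he, h4⟩

/-- The Weyl group of the p.n. root lattice of type `BC_n` contains no strict quasi
Coxeter element: every element `w` of the Weyl group has a reduced presentation whose
subroot lattice is a proper ℤ-submodule of `ℤ^n`. -/
theorem stmt16 (n : ℕ) (hn : 1 ≤ n) (w : (Fin n → ℤ) → (Fin n → ℤ))
    (hw : ∃ l : List (Fin n → ℤ), IsPresZ (PhiBC n) w l) :
    ∃ l : List (Fin n → ℤ), IsPresZ (PhiBC n) w l ∧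
      l.length = clen (PhiBC n) w ∧ Submodule.span ℤ {α | α ∈ l} ≠ ⊤ := by
  have hne : {k | ∃ l, IsPresZ (PhiBC n) w l ∧ l.length = k}.Nonempty := by
    obtain ⟨l, hl⟩ := hw
    exact ⟨_, l, hl, rfl⟩
  obtain ⟨l, hl, hlen⟩ := Nat.sInf_mem hne
  obtain ⟨l', h1, h2, h3, h4⟩ := even_list l hl.1
  refine ⟨l', ⟨h2, h3.trans hl.2⟩, h1.trans hlen, fun htop => ?_⟩
  have key : ∀ v ∈ Submodule.span ℤ {α | α ∈ l'}, Even (∑ k, v k) := by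
    intro v hv
    induction hv using Submodule.span_induction with
    | mem x hx => exact h4 x hx
    | zero => simp
    | add x y _ _ hx hy =>
      simp only [Pi.add_apply, Finset.sum_add_distrib]
      exact hx.add hy
    | smul c x _ hx =>
      simp only [Pi.smul_apply, smul_eq_mul, ← Finset.mul_sum]
      exact hx.mul_left c
  have := key (std n ⟨0, hn⟩) (by rw [htop]; trivial)
  rw [sum_std] at this
  exact absurd this (by decide)
end
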